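/- arXiv:2305.10571 — 3 statements merged into one kernel-verified Lean document; each statement's English description precedes it below -/
import Mathlib

section
/- Let a and b be positive integers with gcd(a,b)=1. Then the number of squarefree integers n with 0 < n < x and n ≡ a (mod b) is asymptotically (x/ζ(2))·(1/b)·∏_{q prime, q|b} (1 − 1/q²)^{−1} as x → ∞. -/
open Filter Real Finset

/-- If `s` is squarefree and `d ^ 2 ∣ k ^ 2 * s`, then `d ∣ k`. -/
lemma Nat.dvd_of_sq_dvd_sq_mul_squarefree {d k s : ℕ} (hk : 0 < k) (hs : Squarefree s)
    (h : d ^ 2 ∣ k ^ 2 * s) : d ∣ k := by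
  obtain ⟨g, d', k', hg, hc, rfl, rfl⟩ := Nat.exists_coprime' (Nat.gcd_pos_of_pos_right d hk)
  have h1 : d' ^ 2 ∣ k' ^ 2 * s := by
    have : g ^ 2 * d' ^ 2 ∣ g ^ 2 * (k' ^ 2 * s) := by
      convert h using 1 <;> ring
    exact Nat.dvd_of_mul_dvd_mul_left (by positivity) this
  have h2 : d' ^ 2 ∣ s := (Nat.Coprime.pow 2 2 hc).dvd_of_dvd_mul_left h1
  have h3 : d' = 1 := Nat.isUnit_iff.mp (hs d' (by simpa [sq] using h2))
  simp [h3]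

/-- The indicator function of the squarefree numbers as a Möbius sum over square divisors. -/
lemma sum_moebius_sq_dvd {n N : ℕ} (hn : 0 < n) (hN : n < N) :
    ∑ d ∈ range N with d ^ 2 ∣ n, ArithmeticFunction.moebius d =
      if Squarefree n then 1 else 0 := by
  obtain ⟨s, k, hs0, hk, rfl, hs⟩ := Nat.sq_mul_squarefree_of_pos hn
  have hset : {d ∈ range N | d ^ 2 ∣ k ^ 2 * s} = k.divisors := by
    ext d
    simp only [mem_filter, mem_range, Nat.mem_divisors]
    constructor
    · rintro ⟨-, h⟩
      exact ⟨Nat.dvd_of_sq_dvd_sq_mul_squarefree hk hs h, hk.ne'⟩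
    · rintro ⟨h, -⟩
      refine ⟨(Nat.le_of_dvd hk h).trans_lt (lt_of_le_of_lt ?_ hN),
        (pow_dvd_pow_of_dvd h 2).mul_right s⟩
      nlinarith
  have hsq : Squarefree (k ^ 2 * s) ↔ k = 1 := by
    constructor
    · intro h
      exact Nat.isUnit_iff.mp (h k ⟨s, by ring⟩)
    · rintro rfl
      simpa using hs
  rw [hset, ← ArithmeticFunction.coe_mul_zeta_apply, ArithmeticFunction.moebius_mul_coe_zeta,
    ArithmeticFunction.one_apply]
  simp [hsq]

/-- The density of a residue class modulo `r` is `1 / r`. -/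
lemma tendsto_card_modEq_div {r : ℕ} (hr : 0 < r) (v : ℕ) :
    Tendsto (fun N : ℕ => (#{n ∈ Ico 1 N | n ≡ v [MOD r]} : ℝ) / N) atTop (nhds (1 / r)) := by
  rw [tendsto_iff_norm_sub_tendsto_zero]
  refine squeeze_zero' (Eventually.of_forall fun _ => norm_nonneg _) ?_
    (tendsto_const_div_atTop_nhds_zero_nat 2)
  filter_upwards [eventually_ge_atTop 1] with N hN
  have hNr : (1 : ℝ) ≤ N := by exact_mod_cast hN
  have hrr : (1 : ℝ) ≤ r := by exact_mod_cast hr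
  have key : |(#{n ∈ Ico 1 N | n ≡ v [MOD r]} : ℚ) - N / r| ≤ 2 := by
    have hc := Nat.Ico_filter_modEq_card 1 N hr v
    have h1 := Int.le_ceil (((N : ℚ) - v) / r)
    have h2 := Int.ceil_lt_add_one (((N : ℚ) - v) / r)
    have h3 := Int.le_ceil ((((1 : ℕ) : ℚ) - v) / r)
    have h4 := Int.ceil_lt_add_one ((((1 : ℕ) : ℚ) - v) / r)
    have hmono : ⌈(((1 : ℕ) : ℚ) - v) / r⌉ ≤ ⌈((N : ℚ) - v) / r⌉ := by
      gcongr
    rw [max_eq_left (by linarith)] at hc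
    have hc' : (#{n ∈ Ico 1 N | n ≡ v [MOD r]} : ℚ) =
        (⌈((N : ℚ) - v) / r⌉ : ℚ) - ⌈(((1 : ℕ) : ℚ) - v) / r⌉ := by exact_mod_cast hc
    have hr1 : (1 : ℚ) / r ≤ 1 := by
      rw [div_le_one (by positivity)]
      exact_mod_cast hr
    have hr0 : (0 : ℚ) ≤ 1 / r := by positivity
    rw [hc', abs_le]
    rw [sub_div] at h1 h2 h3 h4
    push_cast at h1 h2 h3 h4 ⊢
    constructor <;> rw [sub_div, sub_div] <;> linarith
  have key' : |(#{n ∈ Ico 1 N | n ≡ v [MOD r]} : ℝ) - N / r| ≤ 2 := by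
    have := (Rat.cast_le (K := ℝ)).mpr key
    push_cast at this
    exact this
  have : (#{n ∈ Ico 1 N | n ≡ v [MOD r]} : ℝ) / N - 1 / r =
      ((#{n ∈ Ico 1 N | n ≡ v [MOD r]} : ℝ) - N / r) / N := by
    field_simp
  rw [this, Real.norm_eq_abs, abs_div, abs_of_pos (show (0 : ℝ) < N by linarith)]
  gcongr

/-- The density of the multiples of `d ^ 2` in a residue class `a` modulo `b`, for `a` coprime to `b`. -/
lemma tendsto_card_modEq_sq_dvd_div {a b d : ℕ} (hb : 0 < b) (hab : a.Coprime b) (hd : 0 < d) :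
    Tendsto (fun N : ℕ => (#{n ∈ Ico 1 N | n ≡ a [MOD b] ∧ d ^ 2 ∣ n} : ℝ) / N) atTop
      (nhds (if d.Coprime b then 1 / (b * (d : ℝ) ^ 2) else 0)) := by
  split_ifs with hdb
  · have hc : b.Coprime (d ^ 2) := (hdb.pow_left 2).symm
    obtain ⟨c, hc1, hc2⟩ := Nat.chineseRemainder hc a 0
    have := tendsto_card_modEq_div (r := b * d ^ 2) (by positivity) c
    push_cast at this
    refine this.congr fun N => ?_
    congr 3
    refine filter_congr fun n _ => ?_
    rw [← Nat.modEq_and_modEq_iff_modEq_mul hc, ← Nat.modEq_zero_iff_dvd]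
    exact and_congr ⟨fun h => h.trans hc1, fun h => h.trans hc1.symm⟩
      ⟨fun h => h.trans hc2, fun h => h.trans hc2.symm⟩
  · refine tendsto_const_nhds.congr fun N => ?_
    rw [filter_false_of_mem, card_empty, Nat.cast_zero, zero_div]
    rintro n - ⟨h1, h2⟩
    refine hdb ((Nat.Coprime.coprime_dvd_left ((dvd_pow_self d two_ne_zero).trans h2)) ?_)
    rw [Nat.Coprime, h1.gcd_eq]
    exact hab

lemma card_modEq_sq_dvd_div_le (a b d N : ℕ) :
    (#{n ∈ Ico 1 N | n ≡ a [MOD b] ∧ d ^ 2 ∣ n} : ℝ) / N ≤ 1 / (d : ℝ) ^ 2 := by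
  have h : #{n ∈ Ico 1 N | n ≡ a [MOD b] ∧ d ^ 2 ∣ n} ≤ N / d ^ 2 := by
    rw [← Nat.Ioc_filter_dvd_card_eq_div]
    refine card_le_card fun n => ?_
    simp only [mem_filter, mem_Ico, mem_Ioc]
    rintro ⟨h1, -, h2⟩
    exact ⟨by omega, h2⟩
  have h' : (#{n ∈ Ico 1 N | n ≡ a [MOD b] ∧ d ^ 2 ∣ n} : ℝ) ≤ N / (d : ℝ) ^ 2 := by
    refine (Nat.cast_le.mpr h).trans ?_
    exact_mod_cast Nat.cast_div_le (α := ℝ) (m := N) (n := d ^ 2)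
  rcases N.eq_zero_or_pos with rfl | hN
  · simp
  · calc _ ≤ (N / (d : ℝ) ^ 2) / N := by gcongr
      _ = _ := by field_simp

lemma card_squarefree_modEq (a b N : ℕ) :
    (#{n ∈ Ico 1 N | Squarefree n ∧ n ≡ a [MOD b]} : ℝ) =
      ∑' d : ℕ, (ArithmeticFunction.moebius d : ℝ) *
        #{n ∈ Ico 1 N | n ≡ a [MOD b] ∧ d ^ 2 ∣ n} := by
  rw [tsum_eq_sum (s := range N)]
  · have h1 : (#{n ∈ Ico 1 N | Squarefree n ∧ n ≡ a [MOD b]} : ℤ) =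
        ∑ n ∈ Ico 1 N with n ≡ a [MOD b], ∑ d ∈ range N with d ^ 2 ∣ n,
          ArithmeticFunction.moebius d := by
      rw [← filter_filter, filter_comm, card_filter]
      push_cast
      refine sum_congr rfl fun n hn => ?_
      simp only [mem_filter, mem_Ico] at hn
      rw [sum_moebius_sq_dvd (by omega) (by omega)]
    have h2 : (#{n ∈ Ico 1 N | Squarefree n ∧ n ≡ a [MOD b]} : ℤ) =
        ∑ d ∈ range N, ArithmeticFunction.moebius d *
          #{n ∈ Ico 1 N | n ≡ a [MOD b] ∧ d ^ 2 ∣ n} := by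
      rw [h1]
      simp_rw [sum_filter (fun d => d ^ 2 ∣ _)]
      rw [sum_comm]
      refine sum_congr rfl fun d _ => ?_
      rw [← sum_filter, filter_filter, sum_const, nsmul_eq_mul, mul_comm]
    exact_mod_cast h2
  · intro d hd
    rw [filter_false_of_mem, card_empty, Nat.cast_zero, mul_zero]
    rintro n hn ⟨-, h⟩
    simp only [mem_Ico, mem_range] at hn hd
    have := Nat.le_of_dvd (by omega) h
    nlinarith

/-- The Möbius sum over integers coprime to `b` at `2`, as an Euler product. -/
lemma tsum_moebius_coprime_div_sq {b : ℕ} (hb : 0 < b) :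
    ∑' d : ℕ, (ArithmeticFunction.moebius d : ℝ) *
        (if d.Coprime b then 1 / (b * (d : ℝ) ^ 2) else 0) =
      1 / (π ^ 2 / 6) * (1 / b) * ∏ q ∈ b.primeFactors, (1 - 1 / (q : ℝ) ^ 2)⁻¹ := by
  have : NeZero b := ⟨hb.ne'⟩
  have hs : 1 < (2 : ℂ).re := by norm_num
  have h1 := DirichletCharacter.LSeries.mul_mu_eq_one (1 : DirichletCharacter ℂ b) hs
  rw [← DirichletCharacter.LFunction_eq_LSeries _ hs,
    show DirichletCharacter.LFunction (1 : DirichletCharacter ℂ b) 2 = _ from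
      DirichletCharacter.LFunctionTrivChar_eq_mul_riemannZeta (by norm_num), riemannZeta_two] at h1
  have h2 : LSeries ((fun n : ℕ => (1 : DirichletCharacter ℂ b) n) *
      fun n => (ArithmeticFunction.moebius n : ℂ)) 2 =
      ((b * ∑' d : ℕ, (ArithmeticFunction.moebius d : ℝ) *
        (if d.Coprime b then 1 / (b * (d : ℝ) ^ 2) else 0) : ℝ) : ℂ) := by
    rw [← tsum_mul_left, Complex.ofReal_tsum, LSeries]
    refine tsum_congr fun d => ?_
    rcases eq_or_ne d 0 with rfl | hd
    · simp
    rw [LSeries.term_of_ne_zero hd, Pi.mul_apply]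
    split_ifs with hdb
    · rw [MulChar.one_apply ((ZMod.isUnit_iff_coprime d b).mpr hdb)]
      have : (b : ℂ) ≠ 0 := by exact_mod_cast hb.ne'
      push_cast
      rw [show (d : ℂ) ^ (2 : ℂ) = (d : ℂ) ^ 2 by norm_cast]
      field_simp
    · rw [MulChar.map_nonunit _ (mt (ZMod.isUnit_iff_coprime d b).mp hdb)]
      simp
  rw [h2] at h1
  have h3 : ∀ p : ℕ, (1 - (p : ℂ) ^ (-2 : ℂ)) = ((1 - 1 / (p : ℝ) ^ 2 : ℝ) : ℂ) := by
    intro p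
    rw [Complex.cpow_neg, show (p : ℂ) ^ (2 : ℂ) = (p : ℂ) ^ 2 by norm_cast]
    push_cast
    simp
  simp_rw [h3] at h1
  have h4 : (∏ p ∈ b.primeFactors, (1 - 1 / (p : ℝ) ^ 2)) * (π ^ 2 / 6) *
      (b * ∑' d : ℕ, (ArithmeticFunction.moebius d : ℝ) *
        (if d.Coprime b then 1 / (b * (d : ℝ) ^ 2) else 0)) = 1 := by exact_mod_cast h1
  rw [prod_inv_distrib]
  have hb' : (b : ℝ) ≠ 0 := by exact_mod_cast hb.ne'
  have hP : ∏ p ∈ b.primeFactors, (1 - 1 / (p : ℝ) ^ 2) ≠ 0 := by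
    intro h
    rw [h, zero_mul, zero_mul] at h4
    exact zero_ne_one h4
  generalize (∏ p ∈ b.primeFactors, (1 - 1 / (p : ℝ) ^ 2)) = P at *
  generalize (∑' d : ℕ, (ArithmeticFunction.moebius d : ℝ) *
        (if d.Coprime b then 1 / (b * (d : ℝ) ^ 2) else 0)) = T at *
  field_simp
  field_simp at h4
  linarith

/-- The natural density of the squarefree integers in a reduced residue class. -/
lemma tendsto_card_squarefree_modEq_div {a b : ℕ} (hb : 0 < b) (hab : a.Coprime b) :
    Tendsto (fun N : ℕ => (#{n ∈ Ico 1 N | Squarefree n ∧ n ≡ a [MOD b]} : ℝ) / N) atTop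
      (nhds (1 / (π ^ 2 / 6) * (1 / b) * ∏ q ∈ b.primeFactors, (1 - 1 / (q : ℝ) ^ 2)⁻¹)) := by
  rw [← tsum_moebius_coprime_div_sq hb]
  have hsum : Summable fun d : ℕ => 1 / (d : ℝ) ^ 2 :=
    Real.summable_one_div_nat_pow.mpr one_lt_two
  refine (tendsto_tsum_of_dominated_convergence (f := fun N d : ℕ =>
    (ArithmeticFunction.moebius d : ℝ) *
      ((#{n ∈ Ico 1 N | n ≡ a [MOD b] ∧ d ^ 2 ∣ n} : ℝ) / N)) hsum ?_ ?_).congr ?_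
  · intro d
    rcases d.eq_zero_or_pos with rfl | hd
    · simp
    · exact (tendsto_card_modEq_sq_dvd_div hb hab hd).const_mul _
  · refine Eventually.of_forall fun N d => ?_
    have hmu : |(ArithmeticFunction.moebius d : ℝ)| ≤ 1 := by
      exact_mod_cast ArithmeticFunction.abs_moebius_le_one (n := d)
    rw [Real.norm_eq_abs, abs_mul,
      abs_of_nonneg (a := (#{n ∈ Ico 1 N | n ≡ a [MOD b] ∧ d ^ 2 ∣ n} : ℝ) / N) (by positivity)]
    exact (mul_le_of_le_one_left (by positivity) hmu).trans (card_modEq_sq_dvd_div_le a b d N)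
  · intro N
    rw [card_squarefree_modEq, ← tsum_div_const]
    exact tsum_congr fun d => (mul_div_assoc _ _ _).symm

/-- **Prachar–Humphries estimate.** For positive coprime integers `a`, `b`, the number of
squarefree integers `n` with `0 < n < x` and `n ≡ a (mod b)` is asymptotically
`(x / ζ(2)) · (1/b) · ∏_{q prime, q ∣ b} (1 - 1/q²)⁻¹` as `x → ∞`, where `ζ(2) = π²/6`. -/
theorem prachar_humphries (a b : ℕ) (ha : 0 < a) (hb : 0 < b) (hab : Nat.gcd a b = 1) :
    Filter.Tendsto
      (fun x : ℝ =>
        (Nat.card {n : ℕ | 0 < n ∧ (n : ℝ) < x ∧ Squarefree n ∧ n % b = a % b} : ℝ) /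
          (x / (Real.pi ^ 2 / 6) * (1 / (b : ℝ)) *
            ∏ q ∈ b.primeFactors, (1 - 1 / (q : ℝ) ^ 2)⁻¹))
      Filter.atTop (nhds 1) := by
  have hpos : 0 < 1 / (π ^ 2 / 6) * (1 / (b : ℝ)) *
      ∏ q ∈ b.primeFactors, (1 - 1 / (q : ℝ) ^ 2)⁻¹ := by
    refine mul_pos (by positivity) (prod_pos fun q hq => inv_pos.mpr (sub_pos.mpr ?_))
    have hq2 : (1 : ℝ) < q := by exact_mod_cast (Nat.prime_of_mem_primeFactors hq).one_lt
    rw [div_lt_one (by positivity)]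
    exact one_lt_pow₀ hq2 two_ne_zero
  have h := ((tendsto_card_squarefree_modEq_div hb hab).comp
    (tendsto_nat_ceil_atTop (α := ℝ))).mul (tendsto_nat_ceil_div_atTop (R := ℝ))
  have h' := h.div_const (1 / (π ^ 2 / 6) * (1 / (b : ℝ)) *
      ∏ q ∈ b.primeFactors, (1 - 1 / (q : ℝ) ^ 2)⁻¹)
  rw [mul_one, div_self hpos.ne'] at h'
  refine h'.congr' ?_
  filter_upwards [eventually_gt_atTop 0] with x hx
  have hset : {n : ℕ | 0 < n ∧ (n : ℝ) < x ∧ Squarefree n ∧ n % b = a % b} =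
      ((Ico 1 ⌈x⌉₊).filter fun n => Squarefree n ∧ n ≡ a [MOD b] : Finset ℕ) := by
    ext n
    rw [Finset.mem_coe, mem_filter, mem_Ico, Nat.lt_ceil, and_assoc]
    rfl
  have hc : (⌈x⌉₊ : ℝ) ≠ 0 := by
    have := Nat.ceil_pos.mpr hx
    positivity
  rw [hset, Nat.card_coe_set_eq, Set.ncard_coe_finset, Function.comp_apply,
    div_mul_div_cancel₀ hc, div_div]
  congr 1
  ring
end

section
/- Let p > 3 be a prime, let q_1, …, q_r be distinct primes different from p (one of which may equal 2) with N = q_1⋯q_r squarefree, and let k be an integer with 0 ≤ k < r. Then the set of negative fundamental discriminants D with gcd(D, pN) = 1 such that p is inert in ℚ(√D) and the set I = {i ∈ {1, …, r} : q_i is inert in ℚ(√D)} satisfies I ⊆ {k+1, …, r} and #I is odd, has density pN/(2^{k+2}·(p+1)·∏_{i=1}^{r}(q_i+1)) among all negative fundamental discriminants; in particular this density equals the density of the corresponding set in which p is instead required to split in ℚ(√D). -/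
open Filter Finset

/-- `D` is the discriminant of an imaginary quadratic field. -/
def IsNegFundDisc (D : ℤ) : Prop :=
  D < 0 ∧ ((D % 4 = 1 ∧ Squarefree D) ∨
    ∃ d : ℤ, D = 4 * d ∧ Squarefree d ∧ (d % 4 = 2 ∨ d % 4 = 3))

/-- A prime `l` not dividing the negative fundamental discriminant `D` splits in `ℚ(√D)`:
for odd `l` this means the Legendre (= Jacobi) symbol `(D|l) = 1`; `2` splits iff
`D ≡ 1 (mod 8)`. -/
def SplitsIn (l : ℕ) (D : ℤ) : Prop :=
  if l = 2 then D % 8 = 1 else jacobiSym D l = 1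

/-- A prime `l` not dividing the negative fundamental discriminant `D` is inert in `ℚ(√D)`:
for odd `l` this means the Legendre (= Jacobi) symbol `(D|l) = -1`; `2` is inert iff
`D ≡ 5 (mod 8)`. -/
def InertIn (l : ℕ) (D : ℤ) : Prop :=
  if l = 2 then D % 8 = 5 else jacobiSym D l = -1

open scoped Topology

open scoped Classical in
/-- The number of natural numbers below `X` satisfying `P`. -/
noncomputable def countBelow (P : ℕ → Prop) (X : ℕ) : ℕ := Nat.count P X

theorem countBelow_eq_card (P : ℕ → Prop) [DecidablePred P] (X : ℕ) :
    countBelow P X = #{n ∈ range X | P n} := by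
  rw [countBelow, Nat.count_eq_card_filter_range]
  congr

theorem countBelow_le (P : ℕ → Prop) (X : ℕ) : countBelow P X ≤ X := by
  classical
  rw [countBelow_eq_card]
  simpa using card_filter_le (range X) P

theorem countBelow_mul {P : ℕ → Prop} {m : ℕ} (hP : Function.Periodic P m) (k : ℕ) :
    countBelow P (m * k) = k * countBelow P m := by
  classical
  induction k with
  | zero => simp [countBelow]
  | succ k ih =>
    have h : (fun j ↦ P (m * k + j)) = P := by
      funext j
      rw [add_comm, mul_comm]
      exact hP.nat_mul k j
    rw [mul_add_one, add_one_mul, ← ih]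
    simp only [countBelow, Nat.count_add, h]

theorem abs_countBelow_sub_le {P : ℕ → Prop} {m : ℕ} (hP : Function.Periodic P m) (hm : 0 < m)
    (X : ℕ) : |(countBelow P X : ℝ) - X * (countBelow P m / m)| ≤ m := by
  classical
  have h : (fun j ↦ P (m * (X / m) + j)) = P := by
    funext j
    rw [add_comm, mul_comm]
    exact hP.nat_mul (X / m) j
  have hX : countBelow P X = (X / m) * countBelow P m + countBelow P (X % m) := by
    rw [← countBelow_mul hP]
    conv_lhs => rw [← Nat.div_add_mod X m]
    simp only [countBelow, Nat.count_add, h]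
  have h1 : (countBelow P (X % m) : ℝ) ≤ m := by
    exact_mod_cast (countBelow_le _ _).trans (Nat.mod_lt X hm).le
  have h2 : ((X % m : ℕ) : ℝ) ≤ m := by exact_mod_cast (Nat.mod_lt X hm).le
  have h3 : (countBelow P m : ℝ) / m ≤ 1 :=
    div_le_one_of_le₀ (by exact_mod_cast countBelow_le P m) (by positivity)
  have h4 : (X : ℝ) = m * (X / m : ℕ) + (X % m : ℕ) := by exact_mod_cast (Nat.div_add_mod X m).symm
  have hm' : (m : ℝ) ≠ 0 := by positivity
  have h5 : (countBelow P X : ℝ) - X * (countBelow P m / m) =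
      countBelow P (X % m) - (X % m : ℕ) * (countBelow P m / m) := by
    rw [hX, h4]
    push_cast
    field_simp
    ring
  have h6 : ((X % m : ℕ) : ℝ) * (countBelow P m / m) ≤ m * 1 := by gcongr
  have h7 : 0 ≤ ((X % m : ℕ) : ℝ) * (countBelow P m / m) := by positivity
  rw [h5, abs_le]
  constructor <;> linarith [(countBelow P (X % m)).cast_nonneg (α := ℝ)]

/-- The set of natural numbers satisfying `P` has natural density `δ`. -/
def HasNatDensity (P : ℕ → Prop) (δ : ℝ) : Prop :=
  Tendsto (fun X : ℕ ↦ (countBelow P X : ℝ) / X) atTop (𝓝 δ)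

theorem hasNatDensity_of_periodic {P : ℕ → Prop} {m : ℕ} (hP : Function.Periodic P m)
    (hm : 0 < m) : HasNatDensity P (countBelow P m / m) := by
  refine tendsto_iff_norm_sub_tendsto_zero.2 <|
    squeeze_zero' (.of_forall fun _ ↦ norm_nonneg _) ?_
      (tendsto_const_div_atTop_nhds_zero_nat (m : ℝ))
  filter_upwards [eventually_gt_atTop 0] with X hX
  have hX' : (0 : ℝ) < X := by exact_mod_cast hX
  rw [Real.norm_eq_abs, le_div_iff₀ hX', ← abs_of_pos hX', ← abs_mul, abs_of_pos hX', sub_mul,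
    div_mul_cancel₀ _ hX'.ne', mul_comm _ (X : ℝ)]
  exact abs_countBelow_sub_le hP hm X

theorem countBelow_and {P Q : ℕ → Prop} {m n : ℕ} (hP : Function.Periodic P m)
    (hQ : Function.Periodic Q n) (hm : 0 < m) (hn : 0 < n) (hmn : m.Coprime n) :
    countBelow (fun x ↦ P x ∧ Q x) (m * n) = countBelow P m * countBelow Q n := by
  classical
  simp only [countBelow_eq_card, ← card_product]
  refine card_nbij' (fun x ↦ (x % m, x % n))
    (fun y ↦ Nat.chineseRemainder hmn y.1 y.2) ?_ ?_ ?_ ?_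
  · intro x hx
    simp only [coe_filter, mem_range, Set.mem_ofPred_eq] at hx
    simp only [coe_product, coe_filter, mem_range, Set.mem_prod, Set.mem_ofPred_eq,
      hP.map_mod_nat, hQ.map_mod_nat]
    exact ⟨⟨Nat.mod_lt _ hm, hx.2.1⟩, Nat.mod_lt _ hn, hx.2.2⟩
  · rintro ⟨a, b⟩ h
    simp only [coe_product, coe_filter, mem_range, Set.mem_prod, Set.mem_ofPred_eq] at h
    obtain ⟨h1, h2⟩ := (Nat.chineseRemainder hmn a b).2
    simp only [coe_filter, mem_range, Set.mem_ofPred_eq]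
    refine ⟨Nat.chineseRemainder_lt_mul _ _ _ hm.ne' hn.ne', ?_, ?_⟩
    · rw [← hP.map_mod_nat, h1, hP.map_mod_nat]
      exact h.1.2
    · rw [← hQ.map_mod_nat, h2, hQ.map_mod_nat]
      exact h.2.2
  · intro x hx
    simp only [coe_filter, mem_range, Set.mem_ofPred_eq] at hx
    obtain ⟨h1, h2⟩ := (Nat.chineseRemainder hmn (x % m) (x % n)).2
    exact Nat.ModEq.eq_of_lt_of_lt ((Nat.modEq_and_modEq_iff_modEq_mul hmn).1
      ⟨h1.trans (Nat.mod_modEq _ _), h2.trans (Nat.mod_modEq _ _)⟩)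
      (Nat.chineseRemainder_lt_mul _ _ _ hm.ne' hn.ne') hx.1
  · rintro ⟨a, b⟩ h
    simp only [coe_product, coe_filter, mem_range, Set.mem_prod, Set.mem_ofPred_eq] at h
    obtain ⟨h1, h2⟩ := (Nat.chineseRemainder hmn a b).2
    exact Prod.ext (Eq.trans h1 (Nat.mod_eq_of_lt h.1.1)) (Eq.trans h2 (Nat.mod_eq_of_lt h.2.1))

theorem periodic_forall_mem {P : ℕ → ℕ → Prop} {a : ℕ → ℕ} (s : Finset ℕ)
    (hP : ∀ l ∈ s, Function.Periodic (P l) (a l)) :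
    Function.Periodic (fun n ↦ ∀ l ∈ s, P l n) (∏ l ∈ s, a l) := by
  intro n
  refine propext <| forall₂_congr fun l hl ↦ ?_
  obtain ⟨c, hc⟩ := dvd_prod_of_mem a hl
  rw [hc, mul_comm]
  exact iff_of_eq ((hP l hl).nat_mul c n)

theorem countBelow_forall_mem {P : ℕ → ℕ → Prop} {a : ℕ → ℕ} (s : Finset ℕ)
    (hP : ∀ l ∈ s, Function.Periodic (P l) (a l)) (ha : ∀ l ∈ s, 0 < a l)
    (hco : (s : Set ℕ).Pairwise fun l l' ↦ (a l).Coprime (a l')) :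
    countBelow (fun n ↦ ∀ l ∈ s, P l n) (∏ l ∈ s, a l) = ∏ l ∈ s, countBelow (P l) (a l) := by
  classical
  induction s using Finset.induction_on with
  | empty => simp [countBelow]
  | insert l s hl ih =>
    simp only [forall_mem_insert] at hP ha
    rw [coe_insert, Set.pairwise_insert] at hco
    simp only [forall_mem_insert]
    rw [prod_insert hl, prod_insert hl, ← ih hP.2 ha.2 hco.1]
    refine countBelow_and hP.1 (periodic_forall_mem s hP.2) ha.1 (prod_pos ha.2) ?_
    refine Nat.Coprime.prod_right fun l' hl' ↦ (hco.2 l' hl' ?_).1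
    rintro rfl
    exact hl hl'

/-- The modulus such that being a fundamental discriminant at `l` depends only on the residue. -/
def localModulus (l : ℕ) : ℕ := if l = 2 then 16 else l ^ 2

/-- The local condition at the prime `l` for `-n` to be a fundamental discriminant. -/
def IsLocallyFund (l n : ℕ) : Prop :=
  if l = 2 then n % 16 ∈ ({3, 4, 7, 8, 11, 15} : Finset ℕ) else ¬ l ^ 2 ∣ n

theorem localModulus_pos {l : ℕ} (hl : l.Prime) : 0 < localModulus l := by
  unfold localModulus
  split_ifs
  · norm_num
  · exact pow_pos hl.pos 2

theorem coprime_localModulus {l l' : ℕ} (hl : l.Prime) (hl' : l'.Prime) (h : l ≠ l') :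
    (localModulus l).Coprime (localModulus l') := by
  have hc := (Nat.coprime_primes hl hl').2 h
  have (a : ℕ) : ∃ e, localModulus a = a ^ e := by
    unfold localModulus
    split_ifs with ha
    · exact ⟨4, by simp [ha]⟩
    · exact ⟨2, rfl⟩
  obtain ⟨e, he⟩ := this l
  obtain ⟨e', he'⟩ := this l'
  rw [he, he']
  exact hc.pow e e'

theorem periodic_isLocallyFund (l : ℕ) :
    Function.Periodic (IsLocallyFund l) (localModulus l) := by
  intro n
  unfold IsLocallyFund localModulus
  split_ifs
  · simp
  · simp

theorem countBelow_isLocallyFund_two : countBelow (IsLocallyFund 2) (localModulus 2) = 6 := by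
  have : IsLocallyFund 2 = fun n ↦ n % 16 ∈ ({3, 4, 7, 8, 11, 15} : Finset ℕ) := by
    funext n
    simp [IsLocallyFund]
  rw [this, countBelow_eq_card]
  rfl

theorem countBelow_isLocallyFund_add_one {l : ℕ} (hl : l.Prime) (h2 : l ≠ 2) :
    countBelow (IsLocallyFund l) (localModulus l) + 1 = l ^ 2 := by
  classical
  have hpos : 0 < l ^ 2 := pow_pos hl.pos 2
  have h : #{n ∈ range (l ^ 2) | l ^ 2 ∣ n} = 1 := by
    rw [card_eq_one]
    refine ⟨0, ?_⟩
    ext n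
    simp only [mem_filter, mem_range, mem_singleton]
    refine ⟨fun h ↦ Nat.eq_zero_of_dvd_of_lt h.2 h.1, ?_⟩
    rintro rfl
    exact ⟨hpos, dvd_zero _⟩
  have h' := card_filter_add_card_filter_not (s := range (l ^ 2)) (fun n ↦ l ^ 2 ∣ n)
  have : IsLocallyFund l = fun n ↦ ¬ l ^ 2 ∣ n := by
    funext n
    simp [IsLocallyFund, h2]
  rw [countBelow_eq_card, this, localModulus, if_neg h2]
  rw [h, card_range, add_comm] at h'
  convert h'

/-- The proportion of residues satisfying a local condition at `l`. -/
noncomputable def localDensity (A : ℕ → ℕ → Prop) (l : ℕ) : ℝ :=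
  countBelow (A l) (localModulus l) / localModulus l

theorem localDensity_nonneg (A : ℕ → ℕ → Prop) (l : ℕ) : 0 ≤ localDensity A l := by
  unfold localDensity
  positivity

theorem localDensity_le_one (A : ℕ → ℕ → Prop) (l : ℕ) : localDensity A l ≤ 1 :=
  div_le_one_of_le₀ (by exact_mod_cast countBelow_le _ _) (by positivity)

theorem localDensity_isLocallyFund_two : localDensity IsLocallyFund 2 = 3 / 8 := by
  rw [localDensity, countBelow_isLocallyFund_two]
  norm_num [localModulus]

theorem localDensity_isLocallyFund {l : ℕ} (hl : l.Prime) (h2 : l ≠ 2) :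
    localDensity IsLocallyFund l = ((l : ℝ) ^ 2 - 1) / l ^ 2 := by
  have h : (countBelow (IsLocallyFund l) (localModulus l) : ℝ) + 1 = l ^ 2 := by
    exact_mod_cast countBelow_isLocallyFund_add_one hl h2
  rw [localDensity, eq_sub_of_add_eq h, localModulus, if_neg h2]
  push_cast
  rfl

theorem hasNatDensity_forall_mem {A : ℕ → ℕ → Prop}
    (hA : ∀ l, l.Prime → Function.Periodic (A l) (localModulus l)) {s : Finset ℕ}
    (hs : ∀ l ∈ s, l.Prime) :
    HasNatDensity (fun n ↦ ∀ l ∈ s, A l n) (∏ l ∈ s, localDensity A l) := by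
  have h := hasNatDensity_of_periodic (periodic_forall_mem s fun l hl ↦ hA l (hs l hl))
    (prod_pos fun l hl ↦ localModulus_pos (hs l hl))
  rw [countBelow_forall_mem s (fun l hl ↦ hA l (hs l hl))
    (fun l hl ↦ localModulus_pos (hs l hl))
    (fun l hl l' hl' hne ↦ coprime_localModulus (hs l hl) (hs l' hl') hne)] at h
  simpa only [localDensity, prod_div_distrib, Nat.cast_prod] using h

open scoped Classical in
theorem card_exists_sq_dvd_le (y X : ℕ) :
    (#{n ∈ Ioc 0 X | ∃ l, y < l ∧ l ^ 2 ∣ n} : ℝ) ≤ X * (2 / (y + 1)) := by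
  classical
  have hsub : {n ∈ Ioc 0 X | ∃ l, y < l ∧ l ^ 2 ∣ n} ⊆
      (Ioo y (X + 1)).biUnion fun l ↦ {n ∈ Ioc 0 X | l ^ 2 ∣ n} := by
    intro n hn
    simp only [mem_filter, mem_Ioc, mem_biUnion, mem_Ioo] at hn ⊢
    obtain ⟨⟨h0, hX⟩, l, hl, hd⟩ := hn
    have h1 := Nat.le_of_dvd h0 hd
    have h2 := Nat.le_self_pow two_ne_zero l
    exact ⟨l, ⟨hl, by omega⟩, ⟨h0, hX⟩, hd⟩
  calc (#{n ∈ Ioc 0 X | ∃ l, y < l ∧ l ^ 2 ∣ n} : ℝ)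
      ≤ (∑ l ∈ Ioo y (X + 1), X / l ^ 2 : ℕ) := by
        have := (card_le_card hsub).trans card_biUnion_le
        simp only [Nat.Ioc_filter_dvd_card_eq_div] at this
        exact_mod_cast this
    _ ≤ ∑ l ∈ Ioo y (X + 1), X * ((l : ℝ) ^ 2)⁻¹ := by
        push_cast
        refine sum_le_sum fun l _ ↦ ?_
        rw [← div_eq_mul_inv]
        exact_mod_cast Nat.cast_div_le (α := ℝ) (m := X) (n := l ^ 2)
    _ ≤ X * (2 / (y + 1)) := by
        rw [← mul_sum]
        gcongr
        exact sum_Ioo_inv_sq_le y (X + 1)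

/-- Local conditions at finitely many primes refine the conditions for being fundamental. -/
structure IsLocalRefinement (A : ℕ → ℕ → Prop) (L : Finset ℕ) : Prop where
  periodic : ∀ l, l.Prime → Function.Periodic (A l) (localModulus l)
  isLocallyFund : ∀ l, l.Prime → ∀ n, A l n → IsLocallyFund l n
  eq_of_notMem : ∀ l, l ∉ L → A l = IsLocallyFund l

theorem IsLocalRefinement.countBelow_le_add {A : ℕ → ℕ → Prop} {L : Finset ℕ}
    (hA : IsLocalRefinement A L) {y : ℕ} (hy : 2 ≤ y) (hL : ∀ l ∈ L, l ≤ y) (X : ℕ) :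
    (countBelow (fun n ↦ ∀ l ∈ (range (y + 1)).filter Nat.Prime, A l n) X : ℝ) ≤
      countBelow (fun n ↦ ∀ l, l.Prime → A l n) X + X * (2 / (y + 1)) := by
  classical
  refine le_trans ?_ (add_le_add_right (card_exists_sq_dvd_le y X) _)
  simp only [countBelow_eq_card]
  norm_cast
  refine le_trans (card_le_card ?_) (card_union_le _ _)
  intro n hn
  simp only [mem_filter, mem_range, and_imp, mem_union, mem_Ioc] at hn ⊢
  by_cases h : ∀ l, l.Prime → A l n
  · exact .inl ⟨hn.1, h⟩
  · right
    push Not at h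
    obtain ⟨l, hl, hnA⟩ := h
    have hyl : y < l := by
      by_contra! hle
      exact hnA (hn.2 l (by omega) hl)
    rw [hA.eq_of_notMem l fun h ↦ hyl.not_ge (hL l h), IsLocallyFund, if_neg (by omega),
      not_not] at hnA
    refine ⟨⟨?_, hn.1.le⟩, l, hyl, hnA⟩
    have h2 := hA.isLocallyFund 2 Nat.prime_two n (hn.2 2 (by omega) Nat.prime_two)
    rw [Nat.pos_iff_ne_zero]
    rintro rfl
    simp [IsLocallyFund] at h2

theorem countBelow_mono {P Q : ℕ → Prop} (h : ∀ n, P n → Q n) (X : ℕ) :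
    countBelow P X ≤ countBelow Q X := by
  classical
  exact Nat.count_mono_left fun n _ ↦ h n

/-- The density of a set given by local conditions is the product of the local densities. -/
theorem IsLocalRefinement.hasNatDensity {A : ℕ → ℕ → Prop} {L : Finset ℕ}
    (hA : IsLocalRefinement A L) {δ : ℝ}
    (hδ : Tendsto (fun y ↦ ∏ l ∈ (range (y + 1)).filter Nat.Prime, localDensity A l) atTop
      (𝓝 δ)) :
    HasNatDensity (fun n ↦ ∀ l, l.Prime → A l n) δ := by
  have hy : Tendsto (fun y : ℕ ↦ (2 : ℝ) / (y + 1)) atTop (𝓝 0) := by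
    have := (tendsto_const_div_atTop_nhds_zero_nat (2 : ℝ)).comp (tendsto_add_atTop_nat 1)
    simpa [Function.comp_def] using this
  refine Metric.tendsto_atTop'.2 fun ε hε ↦ ?_
  have h3 : 0 < ε / 3 := by positivity
  obtain ⟨y, hy1, hy2, hy3, hy4⟩ := ((Metric.tendsto_nhds.1 hδ _ h3).and
    ((Metric.tendsto_nhds.1 hy _ h3).and
      ((eventually_ge_atTop 2).and (eventually_ge_atTop (L.sup id))))).exists
  have hd := Metric.tendsto_nhds.1 (hasNatDensity_forall_mem hA.periodic
    (s := (range (y + 1)).filter Nat.Prime) (by simp)) _ h3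
  obtain ⟨X₀, hX₀⟩ := eventually_atTop.1 hd
  refine ⟨X₀, fun X hX ↦ ?_⟩
  have hXpos : (0 : ℝ) < X := by exact_mod_cast (Nat.zero_le _).trans_lt hX
  have hle := hA.countBelow_le_add hy3
    (fun l hl ↦ (le_sup (f := id) hl).trans hy4) X
  have hge : (countBelow (fun n ↦ ∀ l, l.Prime → A l n) X : ℝ) ≤
      countBelow (fun n ↦ ∀ l ∈ (range (y + 1)).filter Nat.Prime, A l n) X := by
    exact_mod_cast countBelow_mono (P := fun n ↦ ∀ l : ℕ, l.Prime → A l n)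
      (fun n hn l hl ↦ hn l (mem_filter.1 hl).2) X
  have hle' := (div_le_div_iff_of_pos_right hXpos).2 hle
  have hge' := (div_le_div_iff_of_pos_right hXpos).2 hge
  rw [add_div, mul_div_cancel_left₀ _ hXpos.ne'] at hle'
  have hX1 := hX₀ X hX.le
  rw [Real.dist_eq, abs_lt] at *
  constructor <;> linarith [hX1.1, hX1.2, hy1.1, hy1.2, hy2.1, hy2.2]

theorem exists_tendsto_prod_localDensity : ∃ δ : ℝ, 0 < δ ∧
    Tendsto (fun y ↦ ∏ l ∈ (range (y + 1)).filter Nat.Prime, localDensity IsLocallyFund l) atTop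
      (𝓝 δ) := by
  set f : ℕ → ℝ := fun y ↦ ∏ l ∈ (range (y + 1)).filter Nat.Prime, localDensity IsLocallyFund l
    with hf
  have hsucc (y : ℕ) : f (y + 1) =
      (if (y + 1).Prime then localDensity IsLocallyFund (y + 1) else 1) * f y := by
    simp only [hf, prod_filter]
    rw [prod_range_succ, mul_comm]
  have hnn (y : ℕ) : 0 ≤ f y := prod_nonneg fun l _ ↦ localDensity_nonneg _ l
  have hanti : Antitone f := by
    refine antitone_nat_of_succ_le fun y ↦ ?_
    rw [hsucc]
    refine mul_le_of_le_one_left (hnn y) ?_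
    split_ifs
    · exact localDensity_le_one _ _
    · exact le_rfl
  have hlow (y : ℕ) (hy : 2 ≤ y) : (1 : ℝ) / 4 * ((y + 1) / y) ≤ f y := by
    induction y, hy using Nat.le_induction with
    | base =>
      have : (range 3).filter Nat.Prime = {2} := by decide
      simp only [hf, this, prod_singleton, localDensity_isLocallyFund_two]
      norm_num
    | succ y hy ih =>
      have hy0 : (0 : ℝ) < y := by exact_mod_cast (by omega : 0 < y)
      have hfac : (((y + 1 : ℕ) : ℝ) ^ 2 - 1) / (y + 1 : ℕ) ^ 2 ≤
          if (y + 1).Prime then localDensity IsLocallyFund (y + 1) else 1 := by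
        split_ifs with h
        · exact (localDensity_isLocallyFund h (by omega)).ge
        · exact div_le_one_of_le₀ (by linarith) (by positivity)
      have hnum : (0 : ℝ) ≤ ((y + 1 : ℕ) : ℝ) ^ 2 - 1 := by
        push_cast
        nlinarith
      rw [hsucc]
      refine le_trans (le_of_eq ?_) (mul_le_mul hfac ih (by positivity)
        ((by positivity : (0 : ℝ) ≤ _).trans hfac))
      push_cast
      field_simp
      ring
  have hbdd : BddBelow (Set.range f) := ⟨0, by rintro _ ⟨y, rfl⟩; exact hnn y⟩
  refine ⟨_, ?_, tendsto_atTop_ciInf hanti hbdd⟩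
  refine lt_of_lt_of_le (by norm_num : (0 : ℝ) < 1 / 4)
    (ge_of_tendsto (tendsto_atTop_ciInf hanti hbdd) ?_)
  filter_upwards [eventually_ge_atTop 2] with y hy
  have hy0 : (0 : ℝ) < y := by exact_mod_cast (by omega : 0 < y)
  refine le_trans ?_ (hlow y hy)
  rw [add_div, div_self hy0.ne']
  have : (0 : ℝ) ≤ 1 / y := by positivity
  linarith

theorem localDensity_isLocallyFund_pos {l : ℕ} (hl : l.Prime) :
    0 < localDensity IsLocallyFund l := by
  by_cases h2 : l = 2
  · rw [h2, localDensity_isLocallyFund_two]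
    norm_num
  · rw [localDensity_isLocallyFund hl h2]
    have : (1 : ℝ) < l := by exact_mod_cast hl.one_lt
    have : (0 : ℝ) < (l : ℝ) ^ 2 - 1 := by nlinarith
    positivity

theorem IsLocalRefinement.hasNatDensity_mul {A : ℕ → ℕ → Prop} {L : Finset ℕ}
    (hA : IsLocalRefinement A L) (hL : ∀ l ∈ L, l.Prime) {δ : ℝ}
    (hδ : Tendsto (fun y ↦ ∏ l ∈ (range (y + 1)).filter Nat.Prime, localDensity IsLocallyFund l)
      atTop (𝓝 δ)) :
    HasNatDensity (fun n ↦ ∀ l, l.Prime → A l n)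
      ((∏ l ∈ L, localDensity A l / localDensity IsLocallyFund l) * δ) := by
  refine hA.hasNatDensity ((hδ.const_mul _).congr' ?_)
  filter_upwards [eventually_ge_atTop (L.sup id)] with y hy
  have hsub : L ⊆ (range (y + 1)).filter Nat.Prime := fun l hl ↦ by
    have : l ≤ y := (le_sup (f := id) hl).trans hy
    simp only [mem_filter, mem_range]
    exact ⟨by omega, hL l hl⟩
  rw [prod_subset hsub (f := fun l ↦ localDensity A l / localDensity IsLocallyFund l),
    ← prod_mul_distrib]
  · refine prod_congr rfl fun l hl ↦ div_mul_cancel₀ _ ?_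
    exact (localDensity_isLocallyFund_pos (mem_filter.1 hl).2).ne'
  · intro l hl hlL
    rw [localDensity, hA.eq_of_notMem l hlL]
    exact div_self (localDensity_isLocallyFund_pos (mem_filter.1 hl).2).ne'

/-- The prime `l` is inert (for `b = true`) or split (for `b = false`) at discriminant `-n`. -/
def HasSplittingType (b : Bool) (l n : ℕ) : Prop :=
  if b then InertIn l (-n) else SplitsIn l (-n)

theorem hasSplittingType_two_iff (b : Bool) (n : ℕ) :
    HasSplittingType b 2 n ↔ n % 8 = if b then 3 else 7 := by
  cases b <;> simp [HasSplittingType, InertIn, SplitsIn] <;> omega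

theorem hasSplittingType_iff (b : Bool) {l : ℕ} (h2 : l ≠ 2) (n : ℕ) :
    HasSplittingType b l n ↔ jacobiSym (-n) l = if b then -1 else 1 := by
  cases b <;> simp [HasSplittingType, InertIn, SplitsIn, h2]

theorem jacobiSym_neg_add (l n : ℕ) : jacobiSym (-(n + l : ℕ)) l = jacobiSym (-n) l :=
  jacobiSym.mod_left' (by push_cast; rw [neg_add, ← sub_eq_add_neg, Int.sub_emod_right])

theorem periodic_hasSplittingType (b : Bool) (l : ℕ) :
    Function.Periodic (HasSplittingType b l) (localModulus l) := by
  by_cases h2 : l = 2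
  · subst h2
    intro n
    simp only [hasSplittingType_two_iff, localModulus, if_true]
    congr 1
    omega
  · have h : Function.Periodic (HasSplittingType b l) l := fun n ↦ by
      simp only [hasSplittingType_iff b h2, jacobiSym_neg_add]
    rw [localModulus, if_neg h2, sq]
    exact h.nat_mul l

theorem jacobiSym_neg_eq_zero_iff {l : ℕ} (hl : l.Prime) (n : ℕ) :
    jacobiSym (-n) l = 0 ↔ l ∣ n := by
  have : NeZero l := ⟨hl.ne_zero⟩
  rw [jacobiSym.eq_zero_iff_not_coprime, Int.neg_gcd, Int.gcd_natCast_natCast, ne_eq,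
    ← Nat.coprime_iff_gcd_eq_one, Nat.coprime_comm, hl.coprime_iff_not_dvd, not_not]

theorem HasSplittingType.not_dvd {b : Bool} {l n : ℕ} (hl : l.Prime)
    (h : HasSplittingType b l n) : ¬ l ∣ n := by
  by_cases h2 : l = 2
  · subst h2
    rw [hasSplittingType_two_iff] at h
    cases b <;> simp at h <;> omega
  · rw [hasSplittingType_iff b h2] at h
    rw [← jacobiSym_neg_eq_zero_iff hl, h]
    cases b <;> simp

theorem HasSplittingType.isLocallyFund {b : Bool} {l n : ℕ} (hl : l.Prime)
    (h : HasSplittingType b l n) : IsLocallyFund l n := by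
  by_cases h2 : l = 2
  · subst h2
    rw [hasSplittingType_two_iff] at h
    simp only [IsLocallyFund, if_true, mem_insert, mem_singleton]
    cases b <;> simp at h <;> omega
  · rw [IsLocallyFund, if_neg h2]
    exact fun hd ↦ h.not_dvd hl ((dvd_pow_self l two_ne_zero).trans hd)

theorem hasSplittingType_false_iff {l n : ℕ} (hl : l.Prime) (hf : IsLocallyFund l n)
    (hn : ¬ l ∣ n) : HasSplittingType false l n ↔ ¬ HasSplittingType true l n := by
  by_cases h2 : l = 2
  · subst h2
    simp only [IsLocallyFund, if_true, mem_insert, mem_singleton] at hf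
    simp only [hasSplittingType_two_iff]
    simp
    omega
  · have h0 : jacobiSym (-n) l ≠ 0 := (jacobiSym_neg_eq_zero_iff hl n).not.2 hn
    simp only [hasSplittingType_iff _ h2]
    rcases jacobiSym.trichotomy (-n) l with h | h | h <;> simp_all

theorem sum_range_jacobiSym_neg {l : ℕ} (hl : l.Prime) (h2 : l ≠ 2) :
    ∑ n ∈ range l, jacobiSym (-n) l = 0 := by
  have : Fact l.Prime := ⟨hl⟩
  have h : ∑ a : ZMod l, quadraticChar (ZMod l) (-a) = 0 := by
    rw [← quadraticChar_sum_zero (F := ZMod l) (by rwa [ZMod.ringChar_zmod_n])]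
    exact Equiv.sum_comp (Equiv.neg _) _
  rw [← h]
  refine sum_nbij' (fun n ↦ (n : ZMod l)) ZMod.val (by simp)
    (fun a _ ↦ mem_range.2 a.val_lt) ?_ (by simp) ?_
  · intro n hn
    exact ZMod.val_cast_of_lt (mem_range.1 hn)
  · intro n _
    rw [← jacobiSym.legendreSym.to_jacobiSym, legendreSym]
    push_cast
    rfl

theorem countBelow_hasSplittingType (b : Bool) {l : ℕ} (hl : l.Prime) (h2 : l ≠ 2) :
    2 * countBelow (HasSplittingType b l) l + 1 = l := by
  classical
  have hsub : (#{n ∈ range l | HasSplittingType false l n} : ℤ) -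
      #{n ∈ range l | HasSplittingType true l n} = 0 := by
    rw [← sum_range_jacobiSym_neg hl h2, card_filter, card_filter]
    push_cast
    rw [← sum_sub_distrib]
    refine sum_congr rfl fun n _ ↦ ?_
    simp only [hasSplittingType_iff _ h2]
    rcases jacobiSym.trichotomy (-n) l with h | h | h <;> simp [h]
  have hdvd : #{n ∈ range l | l ∣ n} = 1 := by
    rw [card_eq_one]
    refine ⟨0, ?_⟩
    ext n
    simp only [mem_filter, mem_range, mem_singleton]
    refine ⟨fun h ↦ Nat.eq_zero_of_dvd_of_lt h.2 h.1, ?_⟩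
    rintro rfl
    exact ⟨hl.pos, dvd_zero _⟩
  have hadd : #{n ∈ range l | HasSplittingType false l n} +
      #{n ∈ range l | HasSplittingType true l n} + #{n ∈ range l | l ∣ n} = l := by
    conv_rhs => rw [← card_range l, card_eq_sum_ones]
    simp only [card_filter]
    rw [← sum_add_distrib, ← sum_add_distrib]
    refine sum_congr rfl fun n _ ↦ ?_
    simp only [hasSplittingType_iff _ h2, ← jacobiSym_neg_eq_zero_iff hl]
    rcases jacobiSym.trichotomy (-n) l with h | h | h <;> simp [h]
  rw [countBelow_eq_card]
  cases b <;> omega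

theorem localDensity_hasSplittingType_div (b : Bool) {l : ℕ} (hl : l.Prime)
    {A : ℕ → ℕ → Prop} (hA : A l = HasSplittingType b l) :
    localDensity A l / localDensity IsLocallyFund l = l / (2 * (l + 1)) := by
  by_cases h2 : l = 2
  · subst h2
    have h : countBelow (HasSplittingType b 2) 16 = 2 := by
      rw [show HasSplittingType b 2 = fun n ↦ n % 8 = if b then 3 else 7 from
        funext fun n ↦ propext (hasSplittingType_two_iff b n), countBelow_eq_card]
      cases b <;> rfl
    rw [localDensity_isLocallyFund_two, localDensity, hA, localModulus, if_pos rfl, h]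
    norm_num
  · have hper : Function.Periodic (HasSplittingType b l) l := fun n ↦ by
      simp only [hasSplittingType_iff b h2, jacobiSym_neg_add]
    have hc : 2 * (countBelow (HasSplittingType b l) l : ℝ) + 1 = l := by
      exact_mod_cast countBelow_hasSplittingType b hl h2
    have hl1 : (1 : ℝ) < l := by exact_mod_cast hl.one_lt
    have hl2 : (0 : ℝ) < (l : ℝ) ^ 2 - 1 := by nlinarith
    rw [localDensity_isLocallyFund hl h2, localDensity, hA, localModulus, if_neg h2]
    rw [show l ^ 2 = l * l from sq l, countBelow_mul hper]
    push_cast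
    rw [show (countBelow (HasSplittingType b l) l : ℝ) = (l - 1) / 2 by linarith]
    field_simp
    ring

open scoped Classical in
/-- The local conditions prescribing the splitting type of the primes in `L`. -/
noncomputable def prescribedSplitting (L : Finset ℕ) (s : ℕ → Bool) (l : ℕ) : ℕ → Prop :=
  if l ∈ L then HasSplittingType (s l) l else IsLocallyFund l

theorem isLocalRefinement_prescribedSplitting (L : Finset ℕ) (s : ℕ → Bool) :
    IsLocalRefinement (prescribedSplitting L s) L where
  periodic l _ := by
    unfold prescribedSplitting
    split_ifs
    · exact periodic_hasSplittingType _ _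
    · exact periodic_isLocallyFund _
  isLocallyFund l hl n h := by
    unfold prescribedSplitting at h
    split_ifs at h
    · exact HasSplittingType.isLocallyFund hl h
    · exact h
  eq_of_notMem l h := if_neg h

theorem hasNatDensity_prescribedSplitting {L : Finset ℕ} (hL : ∀ l ∈ L, l.Prime) (s : ℕ → Bool)
    {δ : ℝ}
    (hδ : Tendsto (fun y ↦ ∏ l ∈ (range (y + 1)).filter Nat.Prime, localDensity IsLocallyFund l)
      atTop (𝓝 δ)) :
    HasNatDensity (fun n ↦ ∀ l, l.Prime → prescribedSplitting L s l n)
      ((∏ l ∈ L, (l : ℝ) / (2 * (l + 1))) * δ) := by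
  have h := (isLocalRefinement_prescribedSplitting L s).hasNatDensity_mul hL hδ
  rwa [prod_congr rfl fun l hl ↦
    localDensity_hasSplittingType_div (s l) (hL l hl) (if_pos hl)] at h

theorem hasNatDensity_exists_mem {ι : Type*} {P : ι → ℕ → Prop} {δ : ι → ℝ} (E : Finset ι)
    (hP : ∀ i ∈ E, HasNatDensity (P i) (δ i))
    (hdisj : ∀ i ∈ E, ∀ j ∈ E, ∀ n, P i n → P j n → i = j) :
    HasNatDensity (fun n ↦ ∃ i ∈ E, P i n) (∑ i ∈ E, δ i) := by
  classical
  refine (tendsto_finsetSum E hP).congr fun X ↦ ?_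
  rw [← sum_div, ← Nat.cast_sum]
  congr 2
  simp only [countBelow_eq_card]
  rw [← card_biUnion]
  · congr 1
    ext n
    simp only [mem_biUnion, mem_filter, mem_range]
    tauto
  · intro i hi j hj hij
    refine disjoint_left.2 fun n hni hnj ↦ hij ?_
    exact hdisj i hi j hj n (mem_filter.1 hni).2 (mem_filter.1 hnj).2

theorem squarefree_neg_natCast_iff (n : ℕ) : Squarefree (-n : ℤ) ↔ Squarefree n := by
  rw [← Int.squarefree_natAbs, Int.natAbs_neg, Int.natAbs_natCast]

theorem isNegFundDisc_neg_iff (n : ℕ) :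
    IsNegFundDisc (-n) ↔ ∀ l, l.Prime → IsLocallyFund l n := by
  constructor
  · rintro ⟨hneg, ⟨h4, hsf⟩ | ⟨d, hd, hsf, hd4⟩⟩ l hl
    · have hsf' : Squarefree n := (squarefree_neg_natCast_iff n).1 hsf
      unfold IsLocallyFund
      split_ifs with h2
      · simp only [mem_insert, mem_singleton]
        omega
      · rw [sq]
        exact Nat.squarefree_iff_prime_squarefree.1 hsf' l hl
    · obtain ⟨e, rfl⟩ : ∃ e : ℕ, d = -e := ⟨d.natAbs, by omega⟩
      have hsf' : Squarefree e := (squarefree_neg_natCast_iff e).1 hsf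
      obtain rfl : n = 2 ^ 2 * e := by omega
      unfold IsLocallyFund
      split_ifs with h2
      · simp only [mem_insert, mem_singleton]
        omega
      · intro hdvd
        have hco : (l ^ 2).Coprime (2 ^ 2) :=
          ((Nat.coprime_primes hl Nat.prime_two).2 h2).pow 2 2
        refine Nat.squarefree_iff_prime_squarefree.1 hsf' l hl ?_
        rw [← sq]
        exact hco.dvd_of_dvd_mul_left hdvd
  · intro h
    have h2 := h 2 Nat.prime_two
    simp only [IsLocallyFund, if_true, mem_insert, mem_singleton] at h2
    refine ⟨by omega, ?_⟩
    have hodd (l : ℕ) (hl : l.Prime) (hl2 : l ≠ 2) : ¬ l * l ∣ n := by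
      have := h l hl
      rwa [IsLocallyFund, if_neg hl2, sq] at this
    by_cases h4 : n % 4 = 3
    · left
      refine ⟨by omega, ?_⟩
      refine (squarefree_neg_natCast_iff _).2 <| Nat.squarefree_iff_prime_squarefree.2 fun l hl ↦ by
        by_cases hl2 : l = 2
        · subst hl2
          omega
        · exact hodd l hl hl2
    · right
      obtain ⟨e, rfl⟩ : ∃ e, n = 4 * e := ⟨n / 4, by omega⟩
      refine ⟨-e, by push_cast; ring, ?_, by omega⟩
      refine (squarefree_neg_natCast_iff _).2 <| Nat.squarefree_iff_prime_squarefree.2 fun l hl ↦ by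
        by_cases hl2 : l = 2
        · subst hl2
          omega
        · exact fun hd ↦ hodd l hl hl2 (hd.mul_left 4)

theorem card_filter_odd_powerset_mul_two {α : Type*} {K : Finset α} (hK : K.Nonempty) :
    #{I ∈ K.powerset | Odd #I} * 2 = 2 ^ #K := by
  have h := sum_powerset_neg_one_pow_card_of_nonempty hK
  have h' : ∑ I ∈ K.powerset, (1 - (-1 : ℤ) ^ #I) = 2 ^ #K := by
    rw [sum_sub_distrib, h]
    simp
  have h'' : ∑ I ∈ K.powerset, (1 - (-1 : ℤ) ^ #I) =
      ∑ I ∈ K.powerset, if Odd #I then 2 else 0 := by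
    refine sum_congr rfl fun I _ ↦ ?_
    split_ifs with hI
    · rw [hI.neg_one_pow]
      norm_num
    · rw [(Nat.not_odd_iff_even.1 hI).neg_one_pow]
      norm_num
  rw [h'', ← sum_filter, sum_const, nsmul_eq_mul] at h'
  exact_mod_cast h'

theorem natCard_setOf_eq_countBelow {R : ℤ → Prop} {P : ℕ → Prop} {x : ℝ}
    (h : ∀ D, R D ↔ ∃ n : ℕ, D = -n ∧ P n ∧ (n : ℝ) < x) :
    Nat.card {D : ℤ | R D} = countBelow P ⌈x⌉₊ := by
  classical
  have hR : {D : ℤ | R D} = ({n ∈ range ⌈x⌉₊ | P n}.image fun n : ℕ ↦ (-n : ℤ) : Finset ℤ) := by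
    ext D
    simp only [Set.mem_ofPred_eq, h, coe_image, coe_filter, mem_range, Nat.lt_ceil, Set.mem_image]
    exact exists_congr fun n ↦ ⟨fun ⟨h1, h2, h3⟩ ↦ ⟨⟨h3, h2⟩, h1.symm⟩,
      fun ⟨⟨h3, h2⟩, h1⟩ ↦ ⟨h1.symm, h2, h3⟩⟩
  rw [hR, countBelow_eq_card, Nat.card_coe_set_eq, Set.ncard_coe_finset, card_image_of_injective]
  intro a b hab
  simpa using hab

theorem natCard_isNegFundDisc_and {R : ℤ → Prop} {P : ℕ → Prop}
    (h : ∀ n : ℕ, IsNegFundDisc (-n) ∧ R (-n) ↔ P n) (x : ℝ) :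
    Nat.card {D : ℤ | IsNegFundDisc D ∧ |(D : ℝ)| < x ∧ R D} = countBelow P ⌈x⌉₊ := by
  refine natCard_setOf_eq_countBelow fun D ↦ ⟨?_, ?_⟩
  · rintro ⟨hD, hx, hR⟩
    obtain ⟨n, rfl⟩ : ∃ n : ℕ, D = -n := ⟨D.natAbs, by have := hD.1; omega⟩
    refine ⟨n, rfl, (h n).1 ⟨hD, hR⟩, ?_⟩
    simpa using hx
  · rintro ⟨n, rfl, hP, hx⟩
    obtain ⟨hD, hR⟩ := (h n).2 hP
    exact ⟨hD, by simpa using hx, hR⟩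

section Pattern

variable {r : ℕ} (p : ℕ) (q : Fin r → ℕ) (b : Bool) (I : Finset (Fin r))

/-- Local conditions: `p` has splitting type `b`, and `q i` is inert exactly for `i ∈ I`. -/
noncomputable def patternCondition : ℕ → ℕ → Prop :=
  prescribedSplitting (insert p (univ.image q))
    fun l ↦ if l = p then b else decide (∃ i ∈ I, q i = l)

variable {p q b I}

theorem patternCondition_self : patternCondition p q b I p = HasSplittingType b p := by
  simp [patternCondition, prescribedSplitting]

theorem patternCondition_apply (hqp : ∀ i, q i ≠ p) (hqinj : Function.Injective q) (i : Fin r) :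
    patternCondition p q b I (q i) = HasSplittingType (decide (i ∈ I)) (q i) := by
  simp [patternCondition, prescribedSplitting, hqp, hqinj.eq_iff]

theorem inertIn_iff_of_patternCondition (hq : ∀ i, (q i).Prime) (hqp : ∀ i, q i ≠ p)
    (hqinj : Function.Injective q) {n : ℕ}
    (h : ∀ l, l.Prime → patternCondition p q b I l n) (i : Fin r) :
    InertIn (q i) (-n) ↔ i ∈ I := by
  have hi := h _ (hq i)
  rw [patternCondition_apply hqp hqinj] at hi
  change HasSplittingType true (q i) n ↔ i ∈ I
  by_cases hI : i ∈ I
  · simpa [hI] using hi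
  · have hf := hi.isLocallyFund (hq i)
    have hd := hi.not_dvd (hq i)
    simp only [hI, decide_false, iff_false] at hi ⊢
    exact (hasSplittingType_false_iff (hq i) hf hd).1 hi

theorem forall_patternCondition_iff (hp : p.Prime) (hq : ∀ i, (q i).Prime)
    (hqp : ∀ i, q i ≠ p) (hqinj : Function.Injective q) (n : ℕ) :
    (∀ l, l.Prime → patternCondition p q b I l n) ↔
      IsNegFundDisc (-n) ∧ Int.gcd (-n) ((p : ℤ) * (∏ i, q i : ℕ)) = 1 ∧
        HasSplittingType b p n ∧ ∀ i, InertIn (q i) (-n) ↔ i ∈ I := by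
  have hgcd : Int.gcd (-n) ((p : ℤ) * (∏ i, q i : ℕ)) = 1 ↔ ¬ p ∣ n ∧ ∀ i, ¬ q i ∣ n := by
    rw [← Nat.cast_mul, Int.neg_gcd, Int.gcd_natCast_natCast, ← Nat.coprime_iff_gcd_eq_one,
      Nat.coprime_mul_iff_right, Nat.coprime_prod_right_iff, Nat.coprime_comm,
      hp.coprime_iff_not_dvd]
    refine and_congr_right fun _ ↦ ?_
    simp only [mem_univ, true_imp_iff]
    refine forall_congr' fun i ↦ ?_
    rw [Nat.coprime_comm, (hq i).coprime_iff_not_dvd]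
  rw [hgcd, isNegFundDisc_neg_iff]
  constructor
  · intro h
    have hps : HasSplittingType b p n := patternCondition_self (q := q) (I := I) ▸ h p hp
    refine ⟨fun l hl ↦ (isLocalRefinement_prescribedSplitting _ _).isLocallyFund l hl n (h l hl),
      ⟨hps.not_dvd hp, fun i ↦ ?_⟩, hps, inertIn_iff_of_patternCondition hq hqp hqinj h⟩
    have hi := h _ (hq i)
    rw [patternCondition_apply hqp hqinj] at hi
    exact hi.not_dvd (hq i)
  · rintro ⟨hF, ⟨-, hd⟩, hps, hI⟩ l hl
    by_cases hlp : l = p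
    · subst hlp
      rwa [patternCondition_self]
    by_cases hlq : ∃ i, q i = l
    · obtain ⟨i, rfl⟩ := hlq
      rw [patternCondition_apply hqp hqinj]
      have hIi : HasSplittingType true (q i) n ↔ i ∈ I := hI i
      by_cases hi : i ∈ I
      · simpa [hi] using hIi
      · simp only [hi, decide_false, iff_false] at hIi ⊢
        exact (hasSplittingType_false_iff (hq i) (hF _ hl) (hd i)).2 hIi
    · have : l ∉ insert p (univ.image q) := by
        simpa [hlp] using hlq
      rw [patternCondition, prescribedSplitting, if_neg this]
      exact hF l hl

end Pattern

theorem tendsto_choired_density (b : Bool) {p : ℕ} (hp : p.Prime)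
    {r : ℕ} {q : Fin r → ℕ} (hq : ∀ i, (q i).Prime) (hqp : ∀ i, q i ≠ p)
    (hqinj : Function.Injective q) {k : ℕ} (hk : k < r) :
    Tendsto
      (fun x : ℝ ↦
        (Nat.card {D : ℤ | IsNegFundDisc D ∧ |(D : ℝ)| < x ∧
            Int.gcd D ((p : ℤ) * (∏ i, q i : ℕ)) = 1 ∧
            (if b then InertIn p D else SplitsIn p D) ∧
            (∀ i : Fin r, InertIn (q i) D → k ≤ (i : ℕ)) ∧
            Odd (Nat.card {i : Fin r // InertIn (q i) D})} : ℝ) /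
          (Nat.card {D : ℤ | IsNegFundDisc D ∧ |(D : ℝ)| < x} : ℝ))
      atTop
      (𝓝 ((p : ℝ) * (∏ i, q i : ℕ) /
        (2 ^ (k + 2) * ((p : ℝ) + 1) * ∏ i, ((q i : ℝ) + 1)))) := by
  classical
  obtain ⟨δ, hδpos, hδ⟩ := exists_tendsto_prod_localDensity
  set K : Finset (Fin r) := Ici ⟨k, hk⟩ with hK
  have hpq : p ∉ univ.image q := by simpa using hqp
  have hL : ∀ l ∈ insert p (univ.image q), l.Prime := by simpa [hp] using hq
  have hfund : HasNatDensity (fun n ↦ ∀ l, l.Prime → IsLocallyFund l n) δ := by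
    have := hasNatDensity_prescribedSplitting (L := ∅) (by simp) (fun _ ↦ b) hδ
    simpa [prescribedSplitting] using this
  have hpat : HasNatDensity (fun n ↦ ∃ I ∈ {I ∈ K.powerset | Odd #I},
      ∀ l, l.Prime → patternCondition p q b I l n) _ :=
    hasNatDensity_exists_mem _ (fun I _ ↦ hasNatDensity_prescribedSplitting hL _ hδ)
      fun I _ J _ n hI hJ ↦ by
        ext i
        rw [← inertIn_iff_of_patternCondition hq hqp hqinj hI i,
          inertIn_iff_of_patternCondition hq hqp hqinj hJ i]
  have hlim := (hpat.div hfund hδpos.ne').comp (tendsto_nat_ceil_atTop (α := ℝ))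
  have hval : (∑ I ∈ {I ∈ K.powerset | Odd #I},
      (∏ l ∈ insert p (univ.image q), (l : ℝ) / (2 * (l + 1))) * δ) / δ =
      (p : ℝ) * (∏ i, q i : ℕ) / (2 ^ (k + 2) * ((p : ℝ) + 1) * ∏ i, ((q i : ℝ) + 1)) := by
    have hKcard : #K = r - k := by simp [hK]
    have hodd : (#{I ∈ K.powerset | Odd #I} : ℝ) * 2 * 2 ^ k = 2 ^ r := by
      have := card_filter_odd_powerset_mul_two (K := K) ⟨⟨k, hk⟩, by simp [hK]⟩
      rw [hKcard] at this
      have h2 : #{I ∈ K.powerset | Odd #I} * 2 * 2 ^ k = 2 ^ r := by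
        rw [this, ← pow_add, Nat.sub_add_cancel hk.le]
      exact_mod_cast h2
    have hQ : ∏ i, ((q i : ℝ) + 1) ≠ 0 := prod_ne_zero_iff.2 fun i _ ↦ by positivity
    rw [sum_const, nsmul_eq_mul, ← mul_assoc, mul_div_cancel_right₀ _ hδpos.ne',
      prod_insert hpq, prod_image hqinj.injOn, prod_div_distrib, prod_mul_distrib, prod_const,
      card_univ, Fintype.card_fin, ← hodd]
    have hc : (#{I ∈ K.powerset | Odd #I} : ℝ) ≠ 0 := by
      intro h
      rw [h] at hodd
      simp at hodd
      exact absurd hodd.symm (by positivity)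
    push_cast
    field_simp
    ring
  rw [hval] at hlim
  refine hlim.congr' ?_
  filter_upwards [eventually_gt_atTop 0] with x hx
  have hx' : ((⌈x⌉₊ : ℕ) : ℝ) ≠ 0 := by exact_mod_cast (Nat.ceil_pos.2 hx).ne'
  simp only [Function.comp_apply, Pi.div_apply]
  rw [div_div_div_cancel_right₀ hx']
  congr 2
  · rw [natCard_isNegFundDisc_and (R := fun D ↦ Int.gcd D ((p : ℤ) * (∏ i, q i : ℕ)) = 1 ∧
      (if b then InertIn p D else SplitsIn p D) ∧
      (∀ i : Fin r, InertIn (q i) D → k ≤ (i : ℕ)) ∧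
      Odd (Nat.card {i : Fin r // InertIn (q i) D}))]
    intro n
    simp only [forall_patternCondition_iff hp hq hqp hqinj, mem_filter, mem_powerset]
    constructor
    · rintro ⟨hF, hg, hb, hle, hodd⟩
      refine ⟨univ.filter fun i ↦ InertIn (q i) (-n), ⟨fun i hi ↦ ?_, ?_⟩, hF, hg, hb, by simp⟩
      · simp only [mem_filter, mem_univ, true_and] at hi
        simpa [hK, Fin.le_def] using hle i hi
      · rwa [Nat.card_eq_fintype_card, Fintype.card_subtype] at hodd
    · rintro ⟨I, ⟨hIK, hodd⟩, hF, hg, hb, hI⟩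
      refine ⟨hF, hg, hb, fun i hi ↦ ?_, ?_⟩
      · simpa [hK, Fin.le_def] using hIK ((hI i).1 hi)
      · simp only [hI]
        simpa using hodd
  · have := natCard_isNegFundDisc_and (R := fun _ ↦ True)
      (P := fun n ↦ ∀ l, l.Prime → IsLocallyFund l n)
      (fun n ↦ by rw [isNegFundDisc_neg_iff, and_true]) x
    simpa using this.symm

/-- Density of `Q⁻(choired, p-)`: Let `p > 3` be prime, `q 0, …, q (r-1)` distinct primes
different from `p` with `N = ∏ i, q i` squarefree, and `0 ≤ k < r`. The set of negative
fundamental discriminants `D` coprime to `pN` such that `p` is inert in `ℚ(√D)` and the set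
`I` of indices `i` with `q i` inert in `ℚ(√D)` satisfies `I ⊆ {k, …, r-1}` (indices `0`-based)
and `#I` odd, has density `pN / (2^(k+2) (p+1) ∏ i (q i + 1))` among all negative fundamental
discriminants; in particular this equals the density of the corresponding set where `p` is
instead required to split in `ℚ(√D)`. -/
theorem density_choired_p_inert (p : ℕ) (hp : p.Prime) (hp3 : 3 < p)
    (r : ℕ) (q : Fin r → ℕ) (hq : ∀ i, (q i).Prime) (hqp : ∀ i, q i ≠ p)
    (hqinj : Function.Injective q) (N : ℕ) (hN : N = ∏ i, q i) (hNsf : Squarefree N)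
    (k : ℕ) (hk : k < r) :
    Filter.Tendsto
      (fun x : ℝ =>
        (Nat.card {D : ℤ | IsNegFundDisc D ∧ |(D : ℝ)| < x ∧
            Int.gcd D ((p : ℤ) * N) = 1 ∧ InertIn p D ∧
            (∀ i : Fin r, InertIn (q i) D → k ≤ (i : ℕ)) ∧
            Odd (Nat.card {i : Fin r // InertIn (q i) D})} : ℝ) /
          (Nat.card {D : ℤ | IsNegFundDisc D ∧ |(D : ℝ)| < x} : ℝ))
      Filter.atTop
      (nhds ((p : ℝ) * N /
        (2 ^ (k + 2) * ((p : ℝ) + 1) * ∏ i, ((q i : ℝ) + 1)))) ∧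
    Filter.Tendsto
      (fun x : ℝ =>
        (Nat.card {D : ℤ | IsNegFundDisc D ∧ |(D : ℝ)| < x ∧
            Int.gcd D ((p : ℤ) * N) = 1 ∧ SplitsIn p D ∧
            (∀ i : Fin r, InertIn (q i) D → k ≤ (i : ℕ)) ∧
            Odd (Nat.card {i : Fin r // InertIn (q i) D})} : ℝ) /
          (Nat.card {D : ℤ | IsNegFundDisc D ∧ |(D : ℝ)| < x} : ℝ))
      Filter.atTop
      (nhds ((p : ℝ) * N /
        (2 ^ (k + 2) * ((p : ℝ) + 1) * ∏ i, ((q i : ℝ) + 1)))) := by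
  subst hN
  exact ⟨by simpa using tendsto_choired_density true hp hq hqp hqinj hk,
    by simpa using tendsto_choired_density false hp hq hqp hqinj hk⟩
end

section
/- Let p > 3 be a prime, let q_1, …, q_r be distinct primes different from p (one of which may equal 2) with N = q_1⋯q_r squarefree, and let k be an integer with 0 ≤ k < r. Then the set of negative fundamental discriminants D with gcd(D, pN) = 1 such that the set I = {i ∈ {1, …, r} : q_i is inert in ℚ(√D)} satisfies I ⊆ {k+1, …, r} and #I is odd (with no condition on the behaviour of p in ℚ(√D)), has density pN/(2^{k+1}·(p+1)·∏_{i=1}^{r}(q_i+1)) among all negative fundamental discriminants. -/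
open Filter Finset

open ArithmeticFunction.Moebius in
/-- The constant `∑ μ(d) / d ^ 2`, the sum being over the `d` coprime to `M`. -/
noncomputable def moebiusSqSum (M : ℕ) : ℝ :=
  ∑' d : ℕ, if d.Coprime M then (μ d : ℝ) / (d : ℝ) ^ 2 else 0

open ArithmeticFunction.Moebius in
theorem moebiusSqSum_mul (M : ℕ) [NeZero M] :
    moebiusSqSum M * ((∏ l ∈ M.primeFactors, (1 - ((l : ℝ) ^ 2)⁻¹)) * (Real.pi ^ 2 / 6)) = 1 := by
  have h2 : (1 : ℝ) < (2 : ℂ).re := by norm_num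
  have h := DirichletCharacter.LSeries.mul_mu_eq_one (1 : DirichletCharacter ℂ M) h2
  rw [← DirichletCharacter.LFunction_eq_LSeries _ h2] at h
  have h3 := DirichletCharacter.LFunctionTrivChar_eq_mul_riemannZeta (N := M) (s := 2) (by norm_num)
  rw [DirichletCharacter.LFunctionTrivChar] at h3
  rw [h3, riemannZeta_two] at h
  have h4 : LSeries ((fun n : ℕ => (1 : DirichletCharacter ℂ M) n) * fun n : ℕ => ((μ n : ℤ) : ℂ)) 2
      = (moebiusSqSum M : ℂ) := by
    rw [LSeries, moebiusSqSum, Complex.ofReal_tsum]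
    refine tsum_congr fun d => ?_
    rcases eq_or_ne d 0 with rfl | hd
    · simp
    · rw [LSeries.term_of_ne_zero hd]
      by_cases hc : d.Coprime M
      · have : IsUnit (d : ZMod M) := (ZMod.isUnit_iff_coprime d M).2 hc
        rw [if_pos hc]
        simp [MulChar.one_apply this]
      · have : ¬ IsUnit (d : ZMod M) := fun h => hc ((ZMod.isUnit_iff_coprime d M).1 h)
        simp [hc, MulChar.map_nonunit _ this]
  rw [h4] at h
  rw [mul_comm]
  apply Complex.ofReal_injective
  push_cast
  refine Eq.trans ?_ h
  simp [Complex.cpow_neg]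

open ArithmeticFunction.Moebius in
theorem ite_squarefree_eq_tsum_moebius {n : ℕ} (hn : n ≠ 0) :
    (if Squarefree n then (1 : ℝ) else 0) = ∑' d : ℕ, if d ^ 2 ∣ n then (μ d : ℝ) else 0 := by
  obtain ⟨a, b, hab, ha⟩ := Nat.sq_mul_squarefree n
  have hb : b ≠ 0 := by rintro rfl; simp at hab; exact hn hab.symm
  have key : ∀ d : ℕ, d ^ 2 ∣ n ↔ d ∣ b := by
    intro d
    constructor
    · intro h
      have hdb : 0 < b.gcd d := Nat.gcd_pos_of_pos_left _ (Nat.pos_of_ne_zero hb)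
      obtain ⟨g, b', d', hg, hco, rfl, rfl⟩ := Nat.exists_coprime' hdb
      rw [← hab, mul_pow, mul_pow, mul_right_comm] at h
      have h1 : d' ^ 2 ∣ b' ^ 2 * a := Nat.dvd_of_mul_dvd_mul_right (pow_pos hg 2) h
      have h2 : d' ^ 2 ∣ a := (Nat.Coprime.pow 2 2 hco.symm).dvd_of_dvd_mul_left h1
      have h3 : IsUnit d' := ha d' (by rwa [← sq])
      rw [Nat.isUnit_iff] at h3
      subst h3
      simp
    · intro h
      exact hab ▸ (pow_dvd_pow_of_dvd h 2).mul_right a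
  rw [tsum_eq_sum (s := b.divisors)]
  · rw [Finset.sum_congr rfl (g := fun d => ((μ d : ℤ) : ℝ))]
    · rw [← Int.cast_sum, ← ArithmeticFunction.coe_mul_zeta_apply,
        ArithmeticFunction.moebius_mul_coe_zeta, ArithmeticFunction.one_apply]
      have : Squarefree n ↔ b = 1 := by
        constructor
        · intro h
          exact Nat.isUnit_iff.1 (h b ((sq b) ▸ hab ▸ dvd_mul_right _ _))
        · rintro rfl
          rw [← hab]; simpa using ha
      simp [this]
    · intro d hd
      rw [if_pos ((key d).2 (Nat.dvd_of_mem_divisors hd))]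
  · intro d hd
    rw [if_neg]
    rw [key]
    intro h
    exact hd (Nat.mem_divisors.2 ⟨h, hb⟩)

theorem tendsto_count_modEq_div {r : ℕ} (hr : 0 < r) (v : ℕ) :
    Tendsto (fun X : ℕ => (Nat.count (· ≡ v [MOD r]) X : ℝ) / X) atTop (nhds (1 / r)) := by
  have hr' : (0 : ℝ) < r := by exact_mod_cast hr
  have h1 : Tendsto (fun X : ℕ => (1 : ℝ) / r - 1 / X) atTop (nhds (1 / r)) := by
    simpa using (tendsto_const_nhds (x := (1 : ℝ) / r)).sub (tendsto_one_div_atTop_nhds_zero_nat (𝕜 := ℝ))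
  have h2 : Tendsto (fun X : ℕ => (1 : ℝ) / r + 1 / X) atTop (nhds (1 / r)) := by
    simpa using (tendsto_const_nhds (x := (1 : ℝ) / r)).add (tendsto_one_div_atTop_nhds_zero_nat (𝕜 := ℝ))
  refine tendsto_of_tendsto_of_tendsto_of_le_of_le' h1 h2 ?_ ?_ <;>
    filter_upwards [eventually_gt_atTop 0] with X hX <;>
    have hX' : (0 : ℝ) < X := by exact_mod_cast hX
  all_goals
    have e : ((X / r : ℕ) : ℝ) * r + (X % r : ℕ) = X := by exact_mod_cast Nat.div_add_mod' X r
    have e2 : ((X % r : ℕ) : ℝ) < r := by exact_mod_cast Nat.mod_lt X hr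
    have e3 : (0 : ℝ) ≤ ((X % r : ℕ) : ℝ) := by positivity
    rw [Nat.count_modEq_card _ hr]
  · rw [le_div_iff₀ hX', sub_mul, one_div_mul_cancel hX'.ne', tsub_le_iff_right, div_mul_eq_mul_div,
      div_le_iff₀ hr']
    split_ifs <;> push_cast <;> nlinarith
  · rw [div_le_iff₀ hX', add_mul, one_div_mul_cancel hX'.ne', ← tsub_le_iff_right, div_mul_eq_mul_div,
      le_div_iff₀ hr']
    split_ifs <;> push_cast <;> nlinarith

open ArithmeticFunction.Moebius in
theorem tendsto_squarefree_residue {M : ℕ} (hM : 1 < M) {a : ℤ} (ha : IsCoprime a M) :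
    Tendsto (fun X : ℕ => (#{n ∈ range X | (M : ℤ) ∣ ((n : ℕ) : ℤ) + a ∧ Squarefree n} : ℝ) / X) atTop
      (nhds (moebiusSqSum M / M)) := by
  have hn0 : ∀ n : ℕ, (M : ℤ) ∣ n + a → n ≠ 0 := by
    rintro n h rfl
    have := ha.symm.isUnit_of_dvd' dvd_rfl (by simpa using h)
    rw [Int.isUnit_iff] at this
    omega
  have hco : ∀ d n : ℕ, (M : ℤ) ∣ n + a → d ∣ n → d.Coprime M := by
    intro d n h hd
    rw [← Nat.isCoprime_iff_coprime]
    obtain ⟨c, hc⟩ := h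
    obtain ⟨e, rfl⟩ := hd
    obtain ⟨u, v, huv⟩ := ha
    refine ⟨-u * e, v + u * c, ?_⟩
    push_cast at hc
    linear_combination huv - u * hc
  set S : ℕ → ℕ → Finset ℕ := fun d X => {n ∈ range X | (M : ℤ) ∣ ((n : ℕ) : ℤ) + a ∧ d ^ 2 ∣ n} with hS
  have hsum : ∀ X : ℕ, (#{n ∈ range X | (M : ℤ) ∣ ((n : ℕ) : ℤ) + a ∧ Squarefree n} : ℝ) / X =
      ∑' d : ℕ, (μ d : ℝ) * (#(S d X) / X) := by
    intro X
    have e1 : (#{n ∈ range X | (M : ℤ) ∣ ((n : ℕ) : ℤ) + a ∧ Squarefree n} : ℝ) =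
        ∑ n ∈ range X with (M : ℤ) ∣ ((n : ℕ) : ℤ) + a, ∑' d : ℕ, if d ^ 2 ∣ n then (μ d : ℝ) else 0 := by
      rw [← filter_filter, card_filter, Nat.cast_sum]
      refine Finset.sum_congr rfl fun n hn => ?_
      rw [← ite_squarefree_eq_tsum_moebius (hn0 n (mem_filter.1 hn).2)]
      split_ifs <;> simp
    rw [e1, ← Summable.tsum_finsetSum, ← tsum_div_const]
    · refine tsum_congr fun d => ?_
      rw [← sum_filter, filter_filter, sum_const, nsmul_eq_mul]
      ring
    · intro n hn
      have hn := hn0 n (mem_filter.1 hn).2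
      refine summable_of_ne_finset_zero (s := range (n + 1)) fun d hd => ?_
      rw [if_neg]
      intro h
      refine hd (mem_range.2 (Nat.lt_succ_of_le ?_))
      exact (Nat.le_self_pow two_ne_zero d).trans (Nat.le_of_dvd (Nat.pos_of_ne_zero hn) h)
  simp_rw [hsum]
  have hlim : moebiusSqSum M / M =
      ∑' d : ℕ, (μ d : ℝ) * (if d.Coprime M then 1 / ((d : ℝ) ^ 2 * M) else 0) := by
    rw [moebiusSqSum, ← tsum_div_const]
    refine tsum_congr fun d => ?_
    split_ifs
    · field_simp
    · simp
  rw [hlim]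
  refine tendsto_tsum_of_dominated_convergence (bound := fun d : ℕ => 1 / (d : ℝ) ^ 2)
    (Real.summable_one_div_nat_pow.2 one_lt_two) ?_ ?_
  · intro d
    refine Tendsto.const_mul _ ?_
    split_ifs with hd
    · rcases Nat.eq_zero_or_pos d with rfl | hd0
      · simp at hd; omega
      obtain ⟨v, hv1, hv2⟩ := Nat.chineseRemainder
        ((hd.pow_left 2)) 0 ((-a) % M).toNat
      have hv3 : (M : ℤ) ∣ v + a := by
        have h1 := (Int.natCast_modEq_iff.2 hv2)
        rw [Int.toNat_of_nonneg (Int.emod_nonneg _ (by omega))] at h1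
        have h2 := (h1.trans (Int.mod_modEq _ _)).symm.dvd
        simpa using h2
      have := tendsto_count_modEq_div (r := d ^ 2 * M) (by positivity) v
      push_cast at this
      refine this.congr fun X => ?_
      rw [Nat.count_eq_card_filter_range]
      congr 3
      refine filter_congr fun n _ => ?_
      rw [← Nat.modEq_and_modEq_iff_modEq_mul (hd.pow_left 2), and_comm]
      refine and_congr ?_ ?_
      · rw [Nat.ModEq.comm, Nat.modEq_iff_dvd]
        constructor
        · intro h; exact (by ring : (n : ℤ) + a = (n - v) + (v + a)) ▸ dvd_add h hv3
        · intro h; simpa using dvd_sub h hv3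
      · rw [← Nat.modEq_zero_iff_dvd]
        exact ⟨fun h => h.trans hv1, fun h => h.trans hv1.symm⟩
    · have : ∀ X, S d X = ∅ := by
        intro X
        rw [hS]
        refine filter_false_of_mem fun n _ h => hd ?_
        exact hco d n h.1 ((dvd_pow_self d two_ne_zero).trans h.2)
      simp [this]
  · filter_upwards [eventually_gt_atTop 0] with X hX d
    have hX' : (0 : ℝ) < X := by exact_mod_cast hX
    rw [norm_mul]
    have h1 : ‖(μ d : ℝ)‖ ≤ 1 := by
      rw [Real.norm_eq_abs]
      exact_mod_cast ArithmeticFunction.abs_moebius_le_one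
    have h2 : (#(S d X) : ℝ) ≤ X / (d : ℝ) ^ 2 := by
      have : #(S d X) ≤ X / d ^ 2 := by
        rcases Nat.eq_zero_or_pos d with rfl | hd0
        · have : S 0 X = ∅ := by
            rw [hS]
            refine filter_false_of_mem fun n _ h => hn0 n h.1 ?_
            simpa using h.2
          simp [this]
        rw [← Nat.Ioc_filter_dvd_card_eq_div]
        refine card_le_card fun n hn => ?_
        obtain ⟨h1, h2, h3⟩ := mem_filter.1 hn
        exact mem_filter.2 ⟨mem_Ioc.2 ⟨Nat.pos_of_ne_zero (hn0 n h2), (mem_range.1 h1).le⟩, h3⟩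
      exact (Nat.cast_le.2 this).trans (by exact_mod_cast Nat.cast_div_le (α := ℝ) (m := X) (n := d ^ 2))
    calc _ ≤ 1 * ((X / (d : ℝ) ^ 2) / X) := by
          gcongr
          rw [Real.norm_of_nonneg (by positivity)]
          gcongr
      _ = _ := by field_simp

open Classical in
/-- The number of residues modulo `M`, represented by `0, …, M - 1`, with property `P`. -/
noncomputable def residueCard (M : ℕ) (P : ℤ → Prop) : ℕ :=
  #{a ∈ range M | P ((a : ℕ) : ℤ)}

open Classical in
theorem tendsto_card_neg_squarefree {M : ℕ} (hM : 1 < M) {c : ℕ} (hc : 0 < c) (P : ℤ → Prop)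
    (hP : ∀ a b : ℤ, a ≡ b [ZMOD M] → P a → P b) (hPM : ∀ a, P a → IsCoprime a M) :
    Tendsto (fun x : ℝ =>
      (Nat.card {e : ℤ | e < 0 ∧ Squarefree e ∧ |((c * e : ℤ) : ℝ)| < x ∧ P e} : ℝ) / x) atTop
      (nhds (residueCard M P * (moebiusSqSum M / M) / c)) := by
  rw [residueCard]
  have hc' : (0 : ℝ) < c := by exact_mod_cast hc
  have hM0 : (0 : ℤ) < M := by omega
  have hnat : Tendsto
      (fun X : ℕ => (#{n ∈ range X | P (-((n : ℕ) : ℤ)) ∧ Squarefree n} : ℝ) / X) atTop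
      (nhds (#{a ∈ range M | P ((a : ℕ) : ℤ)} * (moebiusSqSum M / M))) := by
    have h1 := tendsto_finsetSum {a ∈ range M | P ((a : ℕ) : ℤ)} fun a ha =>
      tendsto_squarefree_residue hM (hPM a (mem_filter.1 ha).2)
    rw [sum_const, nsmul_eq_mul] at h1
    refine h1.congr fun X => ?_
    rw [← Finset.sum_div, ← Nat.cast_sum]
    congr 2
    rw [card_eq_sum_card_fiberwise (f := fun n : ℕ => ((-(n : ℤ)) % M).toNat)
      (t := {a ∈ range M | P ((a : ℕ) : ℤ)})]
    · refine Finset.sum_congr rfl fun a ha => ?_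
      obtain ⟨ha1, ha2⟩ := mem_filter.1 ha
      have ha1 := mem_range.1 ha1
      rw [filter_filter]
      congr 1
      refine filter_congr fun n _ => ?_
      have e : ((-(n : ℤ)) % M).toNat = a ↔ (M : ℤ) ∣ n + a := by
        have := Int.emod_nonneg (-(n : ℤ)) hM0.ne'
        have e1 : ((-(n : ℤ)) % M).toNat = a ↔ (-(n : ℤ)) % M = (a : ℤ) % M := by
          rw [Int.emod_eq_of_lt (a := (a : ℤ)) (by omega) (by omega)]
          omega
        rw [e1]
        change _ ≡ _ [ZMOD M] ↔ _
        rw [Int.modEq_iff_dvd, sub_neg_eq_add, add_comm]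
      rw [e]
      constructor
      · rintro ⟨h, hn⟩
        refine ⟨⟨hP a _ ?_ ha2, hn⟩, h⟩
        rw [Int.modEq_iff_dvd, ← dvd_neg]
        simpa [sub_eq_add_neg, add_comm] using h
      · rintro ⟨⟨_, hn⟩, h⟩
        exact ⟨h, hn⟩
    · intro n hn
      obtain ⟨_, hn, _⟩ := mem_filter.1 hn
      have h0 := Int.emod_nonneg (-(n : ℤ)) hM0.ne'
      have h1 := Int.emod_lt_of_pos (-(n : ℤ)) hM0
      refine mem_filter.2 ⟨mem_range.2 (by dsimp only; omega), hP _ _ ?_ hn⟩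
      rw [Int.toNat_of_nonneg h0]
      exact (Int.mod_modEq _ _).symm
  have hcard : ∀ x : ℝ,
      Nat.card {e : ℤ | e < 0 ∧ Squarefree e ∧ |((c * e : ℤ) : ℝ)| < x ∧ P e} =
      #{n ∈ range ⌈x / c⌉₊ | P (-((n : ℕ) : ℤ)) ∧ Squarefree n} := by
    intro x
    rw [← Set.ncard_coe_finset,
      ← Set.ncard_image_of_injective _ (f := fun n : ℕ => -(n : ℤ)) (fun a b h => by simpa using h)]
    change Set.ncard _ = _
    congr 1
    ext e
    simp only [Set.mem_ofPred_eq, Set.mem_image, mem_coe, mem_filter, mem_range, Nat.lt_ceil]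
    constructor
    · rintro ⟨h1, h2, h3, h4⟩
      obtain ⟨n, rfl⟩ : ∃ n : ℕ, e = -(n : ℤ) := ⟨e.natAbs, by omega⟩
      refine ⟨n, ⟨?_, h4, ?_⟩, rfl⟩
      · rw [lt_div_iff₀ hc']
        push_cast at h3
        rw [mul_neg, abs_neg, abs_of_nonneg (by positivity)] at h3
        linarith
      · simpa using Int.squarefree_natAbs.2 h2
    · rintro ⟨n, ⟨h1, h2, h3⟩, rfl⟩
      have := h3.ne_zero
      refine ⟨by omega, ?_, ?_, h2⟩
      · exact Int.squarefree_natAbs.1 (by simpa using h3)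
      · rw [lt_div_iff₀ hc'] at h1
        push_cast
        rw [mul_neg, abs_neg, abs_of_nonneg (by positivity)]
        linarith
  simp_rw [hcard]
  have hce : Tendsto (fun x : ℝ => ⌈x / c⌉₊) atTop atTop :=
    tendsto_nat_ceil_atTop.comp (tendsto_id.atTop_div_const hc')
  have h2 : Tendsto (fun x : ℝ => (⌈x / c⌉₊ : ℝ) / x) atTop (nhds (1 / c)) := by
    have := tendsto_nat_ceil_mul_div_atTop (R := ℝ) (a := 1 / c) (by positivity)
    refine this.congr fun x => ?_
    rw [one_div_mul_eq_div]
  have h3 := (hnat.comp hce).mul h2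
  rw [mul_one_div] at h3
  refine h3.congr' ?_
  filter_upwards [eventually_gt_atTop 0] with x hx
  have : (0 : ℝ) < ⌈x / c⌉₊ := by
    have : 0 < ⌈x / c⌉₊ := Nat.ceil_pos.2 (by positivity)
    exact_mod_cast this
  simp only [Function.comp]
  field_simp

theorem setOf_isNegFundDisc_eq (Q : ℤ → Prop) (x : ℝ) :
    {D : ℤ | IsNegFundDisc D ∧ |(D : ℝ)| < x ∧ Q D} =
      (fun e => ((1 : ℕ) : ℤ) * e) '' {e : ℤ | e < 0 ∧ Squarefree e ∧
        |((((1 : ℕ) : ℤ) * e : ℤ) : ℝ)| < x ∧ e % 4 = 1 ∧ Q (((1 : ℕ) : ℤ) * e)} ∪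
      ((fun e => ((4 : ℕ) : ℤ) * e) '' {e : ℤ | e < 0 ∧ Squarefree e ∧
        |((((4 : ℕ) : ℤ) * e : ℤ) : ℝ)| < x ∧ e % 4 = 3 ∧ Q (((4 : ℕ) : ℤ) * e)} ∪
      (fun e => ((8 : ℕ) : ℤ) * e) '' {e : ℤ | e < 0 ∧ Squarefree e ∧
        |((((8 : ℕ) : ℤ) * e : ℤ) : ℝ)| < x ∧ e % 2 = 1 ∧ Q (((8 : ℕ) : ℤ) * e)}) := by
  ext D
  simp only [Set.mem_ofPred_eq, Set.mem_union, Set.mem_image]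
  constructor
  · rintro ⟨⟨h0, ⟨h4, hsq⟩ | ⟨d, rfl, hsq, h4 | h4⟩⟩, hx, hQ⟩
    · exact Or.inl ⟨D, ⟨h0, hsq, by simpa using hx, h4, by simpa using hQ⟩, by simp⟩
    · obtain ⟨e, rfl⟩ : ∃ e, d = 2 * e := ⟨d / 2, by omega⟩
      have e1 : (4 : ℤ) * (2 * e) = ((8 : ℕ) : ℤ) * e := by push_cast; ring
      rw [e1] at h0 hx hQ
      exact Or.inr (Or.inr ⟨e, ⟨by omega, hsq.squarefree_of_dvd (dvd_mul_left _ _), hx, by omega,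
        hQ⟩, e1.symm⟩)
    · exact Or.inr (Or.inl ⟨d, ⟨by omega, hsq, hx, h4, hQ⟩, by simp⟩)
  · rintro (⟨e, ⟨h0, hsq, hx, h4, hQ⟩, rfl⟩ | ⟨e, ⟨h0, hsq, hx, h4, hQ⟩, rfl⟩ |
      ⟨e, ⟨h0, hsq, hx, h4, hQ⟩, rfl⟩)
    · exact ⟨⟨by omega, Or.inl ⟨by omega, by simpa using hsq⟩⟩, hx, hQ⟩
    · exact ⟨⟨by omega, Or.inr ⟨e, by simp, hsq, by omega⟩⟩, hx, hQ⟩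
    · refine ⟨⟨by omega, Or.inr ⟨2 * e, by push_cast; ring, ?_, by omega⟩⟩, hx, hQ⟩
      rw [squarefree_mul_iff]
      refine ⟨IsCoprime.isRelPrime ⟨-(e / 2), 1, by omega⟩, Int.prime_two.squarefree, hsq⟩

theorem card_isNegFundDisc_eq (Q : ℤ → Prop) (x : ℝ) :
    Nat.card {D : ℤ | IsNegFundDisc D ∧ |(D : ℝ)| < x ∧ Q D} =
      Nat.card {e : ℤ | e < 0 ∧ Squarefree e ∧
        |((((1 : ℕ) : ℤ) * e : ℤ) : ℝ)| < x ∧ e % 4 = 1 ∧ Q (((1 : ℕ) : ℤ) * e)} +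
      (Nat.card {e : ℤ | e < 0 ∧ Squarefree e ∧
        |((((4 : ℕ) : ℤ) * e : ℤ) : ℝ)| < x ∧ e % 4 = 3 ∧ Q (((4 : ℕ) : ℤ) * e)} +
      Nat.card {e : ℤ | e < 0 ∧ Squarefree e ∧
        |((((8 : ℕ) : ℤ) * e : ℤ) : ℝ)| < x ∧ e % 2 = 1 ∧ Q (((8 : ℕ) : ℤ) * e)}) := by
  have hfin : {D : ℤ | IsNegFundDisc D ∧ |(D : ℝ)| < x ∧ Q D}.Finite := by
    refine (Set.finite_Icc (-⌈x⌉) ⌈x⌉).subset fun D hD => ?_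
    have h := abs_lt.1 hD.2.1
    have h1 : (D : ℝ) < ⌈x⌉ := h.2.trans_le (Int.le_ceil x)
    have h2 : ((-⌈x⌉ : ℤ) : ℝ) < D := by
      push_cast
      have := Int.le_ceil x
      linarith
    exact ⟨(Int.cast_lt.1 h2).le, (Int.cast_lt.1 h1).le⟩
  rw [setOf_isNegFundDisc_eq] at hfin ⊢
  have hfin2 := hfin.subset Set.subset_union_right
  change Set.ncard _ = _
  have hinj : ∀ c : ℤ, c ≠ 0 → Function.Injective fun e : ℤ => c * e := fun c hc =>
    mul_right_injective₀ hc
  rw [Set.ncard_union_eq _ (hfin.subset Set.subset_union_left) hfin2,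
    Set.ncard_union_eq _ (hfin2.subset Set.subset_union_left) (hfin2.subset Set.subset_union_right),
    Set.ncard_image_of_injective _ (hinj _ (by norm_num)),
    Set.ncard_image_of_injective _ (hinj _ (by norm_num)),
    Set.ncard_image_of_injective _ (hinj _ (by norm_num))]
  · rfl
  · rw [Set.disjoint_left]
    rintro D ⟨e, he, rfl⟩ ⟨e', he', h⟩
    have h1 := he.2.2.2.1
    have h2 := he'.2.2.2.1
    simp only at h
    omega
  · rw [Set.disjoint_left]
    rintro D ⟨e, he, rfl⟩ (⟨e', he', h⟩ | ⟨e', he', h⟩)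
    all_goals
      have h1 := he.2.2.2.1
      have h2 := he'.2.2.2.1
      simp only at h
      omega

theorem tendsto_card_isNegFundDisc_div {M : ℕ} (hM : 4 ∣ M) (hM0 : 0 < M) (Q : ℤ → Prop)
    (hQ : ∀ a b : ℤ, a ≡ b [ZMOD M] → Q a → Q b)
    (hQM : ∀ c e : ℤ, e % 2 = 1 → Q (c * e) → IsCoprime e M) :
    Tendsto (fun x : ℝ => (Nat.card {D : ℤ | IsNegFundDisc D ∧ |(D : ℝ)| < x ∧ Q D} : ℝ) / x) atTop
      (nhds ((residueCard M (fun a => a % 4 = 1 ∧ Q (1 * a)) +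
        residueCard M (fun a => a % 4 = 3 ∧ Q (4 * a)) / 4 +
        residueCard M (fun a => a % 2 = 1 ∧ Q (8 * a)) / 8) * (moebiusSqSum M / M))) := by
  have h4 : (4 : ℤ) ∣ M := by exact_mod_cast hM
  have hM1 : 1 < M := by omega
  have key : ∀ (c t m : ℕ), 0 < c → (m = 2 ∨ m = 4) → t % 2 = 1 →
      Tendsto (fun x : ℝ => (Nat.card {e : ℤ | e < 0 ∧ Squarefree e ∧ |((c * e : ℤ) : ℝ)| < x ∧
        e % m = t ∧ Q (c * e)} : ℝ) / x) atTop
      (nhds (residueCard M (fun a => a % m = t ∧ Q (c * a)) * (moebiusSqSum M / M) / c)) := by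
    intro c t m hc hm ht
    refine tendsto_card_neg_squarefree hM1 hc (fun e => e % m = t ∧ Q (c * e)) ?_ ?_
    · rintro a b hab ⟨h1, h2⟩
      refine ⟨?_, hQ _ _ (hab.mul_left _) h2⟩
      have h3 : a ≡ b [ZMOD 4] := hab.of_dvd h4
      have h5 : a % 4 = b % 4 := h3
      rcases hm with rfl | rfl <;> push_cast at * <;> omega
    · rintro a ⟨h1, h2⟩
      refine hQM _ _ ?_ h2
      rcases hm with rfl | rfl <;> push_cast at * <;> omega
  have := ((key 1 1 4 (by simp) (by simp) (by simp)).add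
    (((key 4 3 4 (by simp) (by simp) (by simp))).add (key 8 1 2 (by simp) (by simp) (by simp))))
  have e : ∀ A B C K : ℝ, (A + B / 4 + C / 8) * K = A * K / (1 : ℕ) + (B * K / (4 : ℕ)
      + C * K / (8 : ℕ)) := by intros; push_cast; ring
  rw [e]
  simp only [card_isNegFundDisc_eq, Nat.cast_add, add_div]
  simpa only [Nat.cast_ofNat, Nat.cast_one] using this

theorem residueCard_le_of_mul {M : ℕ} (hM : 0 < M) {u : ℤ} (hu : IsCoprime u M) {P Q : ℤ → Prop}
    (hQ : ∀ a b : ℤ, a ≡ b [ZMOD M] → Q a → Q b) (hPQ : ∀ a, P a → Q (a * u)) :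
    residueCard M P ≤ residueCard M Q := by
  classical
  have hM0 : (0 : ℤ) < M := by omega
  refine card_le_card_of_injOn (fun a : ℕ => ((a * u) % M).toNat) ?_ ?_
  · intro a ha
    obtain ⟨_, ha⟩ := mem_filter.1 ha
    have h0 := Int.emod_nonneg (a * u) hM0.ne'
    have h1 := Int.emod_lt_of_pos (a * u) hM0
    refine mem_filter.2 ⟨mem_range.2 (by dsimp only; omega), hQ _ _ ?_ (hPQ _ ha)⟩
    rw [Int.toNat_of_nonneg h0]
    exact (Int.mod_modEq _ _).symm
  · intro a ha b hb hab
    have ha := mem_range.1 (mem_filter.1 ha).1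
    have hb := mem_range.1 (mem_filter.1 hb).1
    have h0 := Int.emod_nonneg (a * u) hM0.ne'
    have h1 := Int.emod_nonneg (b * u) hM0.ne'
    have h2 : (a * u) ≡ (b * u) [ZMOD M] := by
      change _ % _ = _ % _
      dsimp only at hab
      omega
    have h3 : (M : ℤ) ∣ b - a := by
      have := h2.dvd
      rw [← sub_mul] at this
      exact hu.symm.dvd_of_dvd_mul_right this
    have h4 : (a : ℤ) ≡ b [ZMOD M] := (Int.modEq_iff_dvd).2 h3
    have h5 : a ≡ b [MOD M] := Int.natCast_modEq_iff.1 h4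
    rwa [Nat.ModEq, Nat.mod_eq_of_lt ha, Nat.mod_eq_of_lt hb] at h5

theorem residueCard_and_mul_two {M : ℕ} (hM : 0 < M) {u : ℤ} (hu : IsCoprime u M) {P R : ℤ → Prop}
    (hP : ∀ a b : ℤ, a ≡ b [ZMOD M] → P a → P b) (hR : ∀ a b : ℤ, a ≡ b [ZMOD M] → R a → R b)
    (hPu : ∀ a, P a → P (a * u)) (hRu : ∀ a, P a → (R (a * u) ↔ ¬ R a)) :
    residueCard M (fun a => P a ∧ R a) * 2 = residueCard M P := by
  have h1 : residueCard M (fun a => P a ∧ R a) + residueCard M (fun a => P a ∧ ¬ R a) =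
      residueCard M P := by
    classical
    have := card_filter_add_card_filter_not (s := {a ∈ range M | P ((a : ℕ) : ℤ)})
      (fun a : ℕ => R a)
    simp only [filter_filter] at this
    unfold residueCard
    convert this
  have h2 : residueCard M (fun a => P a ∧ R a) ≤ residueCard M (fun a => P a ∧ ¬ R a) :=
    residueCard_le_of_mul hM hu
      (fun a b h ⟨h1, h2⟩ => ⟨hP a b h h1, fun h3 => h2 (hR b a h.symm h3)⟩)
      (fun a ⟨h1, h2⟩ => ⟨hPu a h1, fun h3 => (hRu a h1).1 h3 h2⟩)
  have h3 : residueCard M (fun a => P a ∧ ¬ R a) ≤ residueCard M (fun a => P a ∧ R a) :=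
    residueCard_le_of_mul hM hu
      (fun a b h ⟨h1, h2⟩ => ⟨hP a b h h1, hR a b h h2⟩)
      (fun a ⟨h1, h2⟩ => ⟨hPu a h1, (hRu a h1).2 h2⟩)
  omega

theorem odd_card_flip {ι : Type*} [Finite ι] {I J : ι → Prop} {j : ι} (hj : J j ↔ ¬ I j)
    (h : ∀ i, i ≠ j → (J i ↔ I i)) : Odd (Nat.card {i // J i}) ↔ ¬ Odd (Nat.card {i // I i}) := by
  classical
  have := Fintype.ofFinite ι
  have key : ∀ K : ι → Prop, Nat.card {i // K i} =
      #{i ∈ univ.erase j | K i} + if K j then 1 else 0 := by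
    intro K
    rw [Nat.card_eq_fintype_card, Fintype.card_subtype, ← insert_erase (mem_univ j), filter_insert]
    split_ifs <;> simp
  have e : ({i ∈ univ.erase j | J i} : Finset ι) = {i ∈ univ.erase j | I i} :=
    filter_congr fun i hi => h i (ne_of_mem_erase hi)
  rw [key I, key J, e]
  by_cases hI : I j
  · simp [hI, hj, Nat.odd_add_one]
  · simp [hI, hj, Nat.odd_add_one]

theorem residueCard_odd_mul_two_pow {M : ℕ} (hM : 0 < M) {r : ℕ} (I : Fin r → ℤ → Prop)
    (P : ℤ → Prop) (hP : ∀ a b : ℤ, a ≡ b [ZMOD M] → P a → P b)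
    (hI : ∀ i, ∀ a b : ℤ, a ≡ b [ZMOD M] → I i a → I i b)
    (hflip : ∀ j, ∃ u : ℤ, IsCoprime u M ∧ ∀ a, P a → P (a * u) ∧ (I j (a * u) ↔ ¬ I j a) ∧
      ∀ i, i ≠ j → (I i (a * u) ↔ I i a))
    {k : ℕ} (hk : k < r) :
    residueCard M (fun a => P a ∧ (∀ i, I i a → k ≤ (i : ℕ)) ∧ Odd (Nat.card {i // I i a})) *
      2 ^ (k + 1) = residueCard M P := by
  have hS : ∀ j : ℕ, ∀ a b : ℤ, a ≡ b [ZMOD M] → (P a ∧ ∀ i, I i a → j ≤ (i : ℕ)) →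
      (P b ∧ ∀ i, I i b → j ≤ (i : ℕ)) := fun j a b h ⟨h1, h2⟩ =>
    ⟨hP a b h h1, fun i hi => h2 i (hI i b a h.symm hi)⟩
  have step : ∀ j ≤ r, residueCard M (fun a => P a ∧ ∀ i, I i a → j ≤ (i : ℕ)) * 2 ^ j =
      residueCard M P := by
    intro j
    induction j with
    | zero => intro _; simp
    | succ j ih =>
      intro hj
      rw [← ih (by omega), pow_succ', ← mul_assoc]
      congr 1
      obtain ⟨u, hu, hu2⟩ := hflip ⟨j, hj⟩
      rw [← residueCard_and_mul_two hM hu (hS j) (R := fun a => ¬ I ⟨j, hj⟩ a)]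
      · congr 2
        ext a
        refine ⟨fun ⟨h1, h2⟩ => ⟨⟨h1, fun i hi => (Nat.le_succ j).trans (h2 i hi)⟩, fun h => ?_⟩,
          fun ⟨⟨h1, h2⟩, h3⟩ => ⟨h1, fun i hi => Nat.lt_of_le_of_ne (h2 i hi) ?_⟩⟩
        · have := h2 _ h
          simp at this
        · rintro rfl
          exact h3 hi
      · exact fun a b h h1 h2 => h1 (hI _ b a h.symm h2)
      · rintro a ⟨h1, h2⟩
        obtain ⟨h3, h4, h5⟩ := hu2 a h1
        refine ⟨h3, fun i hi => ?_⟩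
        by_cases hij : i = ⟨j, hj⟩
        · simp [hij]
        · exact h2 i ((h5 i hij).1 hi)
      · rintro a ⟨h1, h2⟩
        rw [(hu2 a h1).2.1]
  rw [← step k hk.le, pow_succ', ← mul_assoc]
  congr 1
  obtain ⟨u, hu, hu2⟩ := hflip ⟨k, hk⟩
  rw [← residueCard_and_mul_two hM hu (hS k) (R := fun a => Odd (Nat.card {i // I i a}))]
  · simp only [and_assoc]
  · intro a b h h1
    have : ∀ i, I i a ↔ I i b := fun i => ⟨hI i a b h, hI i b a h.symm⟩
    simpa only [this] using h1
  · rintro a ⟨h1, h2⟩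
    obtain ⟨h3, h4, h5⟩ := hu2 a h1
    refine ⟨h3, fun i hi => ?_⟩
    by_cases hij : i = ⟨k, hk⟩
    · simp [hij]
    · exact h2 i ((h5 i hij).1 hi)
  · rintro a ⟨h1, h2⟩
    obtain ⟨h3, h4, h5⟩ := hu2 a h1
    exact odd_card_flip h4 h5

theorem residueCard_isCoprime (M : ℕ) : residueCard M (fun a => IsCoprime a M) = M.totient := by
  rw [residueCard, Nat.totient]
  congr 1
  ext a
  simp [Nat.isCoprime_iff_coprime, Nat.coprime_comm]

theorem IsCoprime.of_int_modEq {a b m : ℤ} (h : a ≡ b [ZMOD m]) (ha : IsCoprime a m) :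
    IsCoprime b m := by
  obtain ⟨c, hc⟩ := h.dvd
  obtain rfl : b = a + m * c := by linarith
  exact ha.add_mul_left_left c

theorem emod_two_eq_one_of_isCoprime {a m : ℤ} (hm : 2 ∣ m) (ha : IsCoprime a m) : a % 2 = 1 := by
  by_contra h
  exact Int.prime_two.not_isUnit (ha.isUnit_of_dvd' (Int.dvd_of_emod_eq_zero (by omega)) hm)

theorem residueCard_isCoprime_mod_four {M : ℕ} (hM : 4 ∣ M) (hM0 : 0 < M) :
    residueCard M (fun a => IsCoprime a M ∧ a % 4 = 1) * 2 = M.totient ∧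
    residueCard M (fun a => IsCoprime a M ∧ a % 4 = 3) * 2 = M.totient := by
  have h4 : (4 : ℤ) ∣ M := by exact_mod_cast hM
  have hodd : ∀ a : ℤ, IsCoprime a M → a % 2 = 1 := fun a ha =>
    emod_two_eq_one_of_isCoprime (Dvd.dvd.trans (by norm_num) h4) ha
  rw [← residueCard_isCoprime]
  constructor
  all_goals
    refine residueCard_and_mul_two hM0 (u := -1) isCoprime_one_left.neg_left
      (fun a b h => IsCoprime.of_int_modEq h) ?_ ?_ ?_
    · intro a b h
      have h : a % 4 = b % 4 := h.of_dvd h4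
      omega
    · intro a ha
      simpa using ha.neg_left
    · intro a ha
      have := hodd a ha
      omega

theorem InertIn.mul_iff {l : ℕ} {d u : ℤ} (h : u ≡ 1 [ZMOD l])
    (h2 : l = 2 → u ≡ 1 [ZMOD 8]) : InertIn l (d * u) ↔ InertIn l d := by
  unfold InertIn
  split_ifs with hl2
  · have h3 : d * u ≡ d [ZMOD 8] := by simpa using (h2 hl2).mul_left d
    have h3 : (d * u) % 8 = d % 8 := h3
    rw [h3]
  · rw [jacobiSym.mul_left, jacobiSym.mod_left u, h, ← jacobiSym.mod_left, jacobiSym.one_left,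
      mul_one]

theorem InertIn.congr {l : ℕ} {a b : ℤ} (h : a ≡ b [ZMOD 8 * l]) (hl : InertIn l a) :
    InertIn l b := by
  unfold InertIn at *
  split_ifs at * with hl2
  · have h3 : a % 8 = b % 8 := h.of_dvd (dvd_mul_right _ _)
    rwa [← h3]
  · have h3 : a % l = b % l := h.of_dvd (dvd_mul_left _ _)
    rwa [jacobiSym.mod_left, ← h3, ← jacobiSym.mod_left]

theorem exists_inertIn_flip {l m : ℕ} (hl : l.Prime) (hlm : m.Coprime l) :
    ∃ u : ℤ, u ≡ 1 [ZMOD 4] ∧ IsCoprime u l ∧ u ≡ 1 [ZMOD m] ∧ (l ≠ 2 → u ≡ 1 [ZMOD 8]) ∧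
      ∀ d : ℤ, IsCoprime d l → (l = 2 → d % 4 = 1) → (InertIn l (d * u) ↔ ¬ InertIn l d) := by
  rcases eq_or_ne l 2 with rfl | hl2
  · have h8 : Nat.Coprime 8 m := (Nat.Coprime.pow_right 3 hlm).symm
    obtain ⟨v, hv1, hv2⟩ := Nat.chineseRemainder h8 5 1
    have hv1 : (v : ℤ) ≡ 5 [ZMOD 8] := by exact_mod_cast Int.natCast_modEq_iff.2 hv1
    have hv2 : (v : ℤ) ≡ 1 [ZMOD m] := by exact_mod_cast Int.natCast_modEq_iff.2 hv2
    have hv3 : (v : ℤ) % 8 = 5 := hv1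
    refine ⟨v, ?_, ⟨1, -(v / 2), ?_⟩, hv2, by simp, fun d _ hd => ?_⟩
    · change _ % _ = _ % _
      omega
    · push_cast
      omega
    · have hd := hd rfl
      simp only [InertIn, if_true]
      rw [Int.mul_emod, hv3]
      omega
  · have : Fact l.Prime := ⟨hl⟩
    have hlo : l.Coprime 2 := hl.coprime_iff_not_dvd.2 fun h =>
      hl2 ((Nat.prime_dvd_prime_iff_eq hl Nat.prime_two).1 h)
    have h8 : Nat.Coprime l (8 * m) := (Nat.Coprime.pow_right 3 hlo).mul_right hlm.symm
    obtain ⟨x, hx⟩ := FiniteField.exists_nonsquare (F := ZMod l) (by rwa [ZMod.ringChar_zmod_n])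
    obtain ⟨v, hv1, hv2⟩ := Nat.chineseRemainder h8 x.val 1
    have hvx : ((v : ℕ) : ZMod l) = x := by
      rw [(ZMod.natCast_eq_natCast_iff _ _ _).2 hv1, ZMod.natCast_zmod_val]
    have hv2 : (v : ℤ) ≡ 1 [ZMOD 8 * m] := by exact_mod_cast Int.natCast_modEq_iff.2 hv2
    have hj : jacobiSym v l = -1 := by
      rw [← jacobiSym.legendreSym.to_jacobiSym, legendreSym.eq_neg_one_iff]
      simpa [hvx] using hx
    have hv8 := hv2.of_dvd (dvd_mul_right 8 (m : ℤ))
    refine ⟨v, hv8.of_dvd (by norm_num), ?_, hv2.of_dvd (dvd_mul_left _ _), fun _ => hv8,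
      fun d hd _ => ?_⟩
    · rw [Int.isCoprime_iff_gcd_eq_one]
      by_contra h
      have := jacobiSym.eq_zero_iff_not_coprime.2 h
      omega
    · simp only [InertIn, hl2, if_false]
      rw [jacobiSym.mul_left, hj]
      have := jacobiSym.eq_one_or_neg_one (Int.isCoprime_iff_gcd_eq_one.1 hd)
      omega

theorem totient_mul_moebiusSqSum {M : ℕ} (hM : 0 < M) :
    M.totient * (moebiusSqSum M / M) = (∏ l ∈ M.primeFactors, (l : ℝ) / (l + 1)) /
      (Real.pi ^ 2 / 6) := by
  have : NeZero M := ⟨hM.ne'⟩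
  have hM' : (M : ℝ) ≠ 0 := by exact_mod_cast hM.ne'
  have h1 : (M.totient : ℝ) = M * ∏ l ∈ M.primeFactors, (1 - (l : ℝ)⁻¹) := by
    have := congrArg (fun z : ℚ => (z : ℝ)) (Nat.totient_eq_mul_prod_factors M)
    push_cast at this
    exact this
  have h2 : ∏ l ∈ M.primeFactors, (1 - (l : ℝ)⁻¹) = (∏ l ∈ M.primeFactors, (l : ℝ) / (l + 1)) *
      ∏ l ∈ M.primeFactors, (1 - ((l : ℝ) ^ 2)⁻¹) := by
    rw [← prod_mul_distrib]
    refine prod_congr rfl fun l hl => ?_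
    have : (0 : ℝ) < l := by exact_mod_cast (Nat.prime_of_mem_primeFactors hl).pos
    field_simp
    ring
  have h3 := moebiusSqSum_mul M
  have hpi : Real.pi ^ 2 / 6 ≠ 0 := by positivity
  rw [eq_div_iff hpi, h1, h2]
  field_simp at h3 ⊢
  linear_combination (∏ l ∈ M.primeFactors, (l : ℝ) / (l + 1)) * h3

theorem residueCard_eq_zero {M : ℕ} {P : ℤ → Prop} (h : ∀ a, ¬ P a) : residueCard M P = 0 := by
  simp [residueCard, h]

theorem isCoprime_of_modEq_one {u m : ℤ} (h : u ≡ 1 [ZMOD m]) : IsCoprime u m :=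
  isCoprime_one_left.of_int_modEq h.symm

theorem isCoprime_of_odd {a : ℤ} (h : a % 2 = 1) (n : ℕ) : IsCoprime a (2 ^ n) :=
  IsCoprime.pow_right ⟨1, -(a / 2), by omega⟩

theorem tendsto_card_isNegFundDisc_lt_div :
    Tendsto (fun x : ℝ => (Nat.card {D : ℤ | IsNegFundDisc D ∧ |(D : ℝ)| < x} : ℝ) / x) atTop
      (nhds (1 / (2 * (Real.pi ^ 2 / 6)))) := by
  have h := tendsto_card_isNegFundDisc_div (M := 4) dvd_rfl (by norm_num) (fun _ => True)
    (fun _ _ _ h => h) (fun c e he _ => isCoprime_of_odd he 2)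
  have h4 := residueCard_isCoprime_mod_four (M := 4) dvd_rfl (by norm_num)
  have h5 := residueCard_isCoprime 4
  have ht : Nat.totient 4 = 2 := by decide
  have hcop : ∀ a : ℤ, IsCoprime a (4 : ℕ) ↔ a % 2 = 1 := fun a =>
    ⟨emod_two_eq_one_of_isCoprime (by norm_num), fun h => isCoprime_of_odd h 2⟩
  have e1 : ∀ a : ℤ, (a % 2 = 1 ∧ a % 4 = 1) ↔ a % 4 = 1 := by intro a; omega
  have e3 : ∀ a : ℤ, (a % 2 = 1 ∧ a % 4 = 3) ↔ a % 4 = 3 := by intro a; omega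
  simp only [hcop, e1, e3, ht] at h4 h5
  have hmain := totient_mul_moebiusSqSum (M := 4) (by norm_num)
  have hpf : Nat.primeFactors 4 = {2} := by
    rw [show 4 = 2 ^ 2 by norm_num, Nat.primeFactors_prime_pow two_ne_zero Nat.prime_two]
  rw [hpf, ht, prod_singleton] at hmain
  have e4 : residueCard 4 (fun a => a % 4 = 1) = 1 := by omega
  have e5 : residueCard 4 (fun a => a % 4 = 3) = 1 := by omega
  simp only [and_true, e4, e5, h5] at h
  convert h using 2
  rw [← mul_right_inj' (two_ne_zero (α := ℝ)), mul_left_comm]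
  push_cast at hmain ⊢
  rw [hmain]
  field_simp
  norm_num

theorem residueCard_inertIn_mul_two_pow {p : ℕ} (hp : p.Prime) {r : ℕ} {q : Fin r → ℕ}
    (hq : ∀ i, (q i).Prime) (hqp : ∀ i, q i ≠ p) (hqinj : Function.Injective q) {k : ℕ}
    (hk : k < r) (c : ℤ) (T : ℤ → Prop) (hT : ∀ a b : ℤ, a ≡ b [ZMOD 4] → T a → T b)
    (hTodd : ∀ a, T a → a % 2 = 1) (hc : IsCoprime c ((p : ℤ) * (∏ i, q i : ℕ)))
    (h2 : ∀ i, q i = 2 → ∀ a, T a → (c * a) % 4 = 1) :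
    residueCard (8 * (p * ∏ i, q i)) (fun a => T a ∧
      Int.gcd (c * a) ((p : ℤ) * (∏ i, q i : ℕ)) = 1 ∧
      (∀ i : Fin r, InertIn (q i) (c * a) → k ≤ (i : ℕ)) ∧
      Odd (Nat.card {i : Fin r // InertIn (q i) (c * a)})) * 2 ^ (k + 1) =
    residueCard (8 * (p * ∏ i, q i)) (fun a => IsCoprime a (8 * (p * ∏ i, q i) : ℕ) ∧ T a) := by
  set N := ∏ i, q i with hN
  have hN0 : 0 < N := prod_pos fun i _ => (hq i).pos
  have hqN : ∀ i, ((q i : ℕ) : ℤ) ∣ (p : ℤ) * N := fun i =>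
    Dvd.dvd.mul_left (by exact_mod_cast dvd_prod_of_mem q (mem_univ i)) _
  have hcast : ((8 * (p * N) : ℕ) : ℤ) = 2 ^ 3 * ((p : ℤ) * N) := by push_cast; ring
  have h4 : (4 : ℤ) ∣ (8 * (p * N) : ℕ) := by rw [hcast]; exact Dvd.dvd.mul_right (by norm_num) _
  rw [← residueCard_odd_mul_two_pow (by have := hp.pos; positivity)
    (fun i a => InertIn (q i) (c * a)) (fun a => IsCoprime a (8 * (p * N) : ℕ) ∧ T a) ?_ ?_ ?_ hk]
  · congr 2
    ext a
    rw [← Int.isCoprime_iff_gcd_eq_one, hcast, IsCoprime.mul_left_iff,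
      IsCoprime.mul_right_iff (y := (2 : ℤ) ^ 3)]
    constructor
    · rintro ⟨ha, ⟨_, hb⟩, h⟩
      exact ⟨⟨⟨isCoprime_of_odd (hTodd a ha) 3, hb⟩, ha⟩, h⟩
    · rintro ⟨⟨⟨_, hb⟩, ha⟩, h⟩
      exact ⟨ha, ⟨hc, hb⟩, h⟩
  · rintro a b h ⟨ha, hb⟩
    exact ⟨ha.of_int_modEq h, hT a b (h.of_dvd h4) hb⟩
  · intro i a b h hi
    refine InertIn.congr ((h.mul_left c).of_dvd ?_) hi
    rw [hcast]
    exact mul_dvd_mul (by norm_num) (hqN i)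
  · intro j
    have hcop : (p * ∏ i ∈ univ.erase j, q i).Coprime (q j) := by
      refine Nat.Coprime.mul_left ((Nat.coprime_primes hp (hq j)).2 (hqp j).symm)
        (Nat.Coprime.prod_left fun i hi => ?_)
      exact (Nat.coprime_primes (hq i) (hq j)).2 fun h => ne_of_mem_erase hi (hqinj h)
    obtain ⟨u, hu4, huj, hum, hu8, hflip⟩ := exists_inertIn_flip (hq j) hcop
    have hNj : N = q j * ∏ i ∈ univ.erase j, q i := (mul_prod_erase _ _ (mem_univ j)).symm
    have hu : IsCoprime u (8 * (p * N) : ℕ) := by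
      rw [hcast]
      refine IsCoprime.mul_right (isCoprime_of_odd ?_ 3) ?_
      · have : u % 4 = 1 := hu4
        omega
      · have e : (p : ℤ) * N = q j * (p * ∏ i ∈ univ.erase j, q i : ℕ) := by
          rw [hNj]; push_cast; ring
        rw [e]
        exact huj.mul_right (isCoprime_of_modEq_one hum)
    refine ⟨u, hu, fun a ⟨ha, hTa⟩ => ⟨⟨ha.mul_left hu, hT a _ ?_ hTa⟩, ?_, fun i hij => ?_⟩⟩
    · simpa using (hu4.mul_left a).symm
    · rw [← mul_assoc]
      refine hflip _ ?_ fun h => h2 j h a hTa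
      rw [hcast] at ha
      exact (hc.mul_left (ha.of_isCoprime_of_dvd_right (dvd_mul_left _ _))).of_isCoprime_of_dvd_right
        (hqN j)
    · rw [← mul_assoc]
      refine InertIn.mul_iff (hum.of_dvd ?_) fun h => hu8 fun h' => hij (hqinj (h.trans h'.symm))
      exact_mod_cast Dvd.dvd.mul_left (dvd_prod_of_mem q (mem_erase.2 ⟨hij, mem_univ i⟩)) _

theorem prod_primeFactors_mul_prod {p : ℕ} (hp : p.Prime) {r : ℕ} {q : Fin r → ℕ}
    (hq : ∀ i, (q i).Prime) (hqp : ∀ i, q i ≠ p) (hqinj : Function.Injective q) :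
    ∏ l ∈ (p * ∏ i, q i).primeFactors, (l : ℝ) / (l + 1) =
      (p / (p + 1)) * ∏ i, (q i : ℝ) / (q i + 1) := by
  classical
  have h1 : (∏ i, q i).primeFactors = univ.image q := by
    rw [← Nat.primeFactors_prod (s := univ.image q), prod_image hqinj.injOn]
    simpa using hq
  have hcop : p.Coprime (∏ i, q i) := Nat.Coprime.prod_right fun i _ =>
    (Nat.coprime_primes hp (hq i)).2 (hqp i).symm
  rw [hcop.primeFactors_mul, prod_union hcop.disjoint_primeFactors, hp.primeFactors,
    prod_singleton, h1, prod_image hqinj.injOn]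

theorem tendsto_card_inertIn_div {p : ℕ} (hp : p.Prime) (hp3 : 3 < p) {r : ℕ} {q : Fin r → ℕ}
    (hq : ∀ i, (q i).Prime) (hqp : ∀ i, q i ≠ p) (hqinj : Function.Injective q) {k : ℕ}
    (hk : k < r) :
    Tendsto (fun x : ℝ => (Nat.card {D : ℤ | IsNegFundDisc D ∧ |(D : ℝ)| < x ∧
      Int.gcd D ((p : ℤ) * (∏ i, q i : ℕ)) = 1 ∧
      (∀ i : Fin r, InertIn (q i) D → k ≤ (i : ℕ)) ∧
      Odd (Nat.card {i : Fin r // InertIn (q i) D})} : ℝ) / x) atTop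
    (nhds ((p / (p + 1)) * (∏ i, (q i : ℝ) / (q i + 1)) /
      (2 ^ (k + 2) * (Real.pi ^ 2 / 6)))) := by
  set N := ∏ i, q i with hN
  have hN0 : 0 < N := prod_pos fun i _ => (hq i).pos
  have hpN0 : 0 < p * N := Nat.mul_pos hp.pos hN0
  have hqN : ∀ i, ((q i : ℕ) : ℤ) ∣ (p : ℤ) * N := fun i =>
    Dvd.dvd.mul_left (by exact_mod_cast dvd_prod_of_mem q (mem_univ i)) _
  have hcast : ((8 * (p * N) : ℕ) : ℤ) = 8 * ((p : ℤ) * N) := by push_cast; ring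
  have h := tendsto_card_isNegFundDisc_div (M := 8 * (p * N)) ⟨2 * (p * N), by ring⟩ (by positivity)
    (fun D => Int.gcd D ((p : ℤ) * N) = 1 ∧ (∀ i : Fin r, InertIn (q i) D → k ≤ (i : ℕ)) ∧
      Odd (Nat.card {i : Fin r // InertIn (q i) D})) ?_ ?_
  · set A : ℤ → (ℤ → Prop) → ℕ := fun c T => residueCard (8 * (p * N)) (fun a => T a ∧
      Int.gcd (c * a) ((p : ℤ) * N) = 1 ∧
      (∀ i : Fin r, InertIn (q i) (c * a) → k ≤ (i : ℕ)) ∧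
      Odd (Nat.card {i : Fin r // InertIn (q i) (c * a)})) with hA
    change Tendsto _ _ (nhds ((A 1 (fun a => a % 4 = 1) + A 4 (fun a => a % 4 = 3) / 4 +
      A 8 (fun a => a % 2 = 1) / 8) * (moebiusSqSum (8 * (p * N)) / (8 * (p * N) : ℕ)))) at h
    have hcount := residueCard_inertIn_mul_two_pow hp hq hqp hqinj hk
    obtain ⟨hR1, hR3⟩ := residueCard_isCoprime_mod_four (M := 8 * (p * N)) ⟨2 * (p * N), by ring⟩
      (by positivity)
    have hR := residueCard_isCoprime (8 * (p * N))
    have hmod : ∀ {a b : ℤ}, a ≡ b [ZMOD 4] → a % 4 = b % 4 := fun h => h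
    have h1 : A 1 (fun a => a % 4 = 1) * 2 ^ (k + 2) = (8 * (p * N)).totient := by
      rw [← hR1, ← hcount 1 (fun a => a % 4 = 1) (fun a b h h' => (hmod h).symm.trans h')
        (fun a h => by omega) isCoprime_one_left (fun _ _ a h => by rwa [one_mul]),
        pow_succ, mul_assoc]
    have hmain := totient_mul_moebiusSqSum (M := 8 * (p * N)) (by positivity)
    rw [← h1] at hmain
    have hprod := prod_primeFactors_mul_prod hp hq hqp hqinj
    rw [← hN] at hprod
    rw [← hprod]
    have hpf : (8 * (p * N)).primeFactors = {2} ∪ (p * N).primeFactors := by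
      rw [Nat.primeFactors_mul (by norm_num) hpN0.ne', show 8 = 2 ^ 3 by norm_num,
        Nat.primeFactors_prime_pow three_ne_zero Nat.prime_two]
    rw [hpf] at hmain
    convert h using 2
    generalize moebiusSqSum (8 * (p * N)) / ((8 * (p * N) : ℕ) : ℝ) = K at hmain ⊢
    by_cases hN2 : ∃ i, q i = 2
    · have h2 : 2 ∣ p * N := by
        obtain ⟨i, hi⟩ := hN2
        exact Dvd.dvd.mul_left (hi ▸ dvd_prod_of_mem q (mem_univ i)) _
      have hzero : ∀ c T, (2 : ℤ) ∣ c → A c T = 0 := by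
        refine fun c T hc => residueCard_eq_zero ?_
        rintro a ⟨-, h, -⟩
        have h3 : (2 : ℤ) ∣ (p : ℤ) * N := by exact_mod_cast h2
        have := Int.dvd_coe_gcd (hc.mul_right a) h3
        rw [h] at this
        norm_num at this
      rw [union_eq_right.2 (by simpa only [singleton_subset_iff, Nat.mem_primeFactors] using
        ⟨Nat.prime_two, h2, hpN0.ne'⟩)] at hmain
      rw [hzero 4 _ (by norm_num), hzero 8 _ (by norm_num)]
      rw [mul_comm (2 ^ (k + 2) : ℝ), ← div_div, ← hmain]
      push_cast
      field_simp
      ring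
    · push Not at hN2
      have h2 : Nat.Coprime 2 (p * N) := Nat.Coprime.mul_right
        ((Nat.coprime_primes Nat.prime_two hp).2 (by omega))
        (Nat.Coprime.prod_right fun i _ => (Nat.coprime_primes Nat.prime_two (hq i)).2 (hN2 i).symm)
      have h2' : ∀ n : ℕ, IsCoprime ((2 : ℤ) ^ n) ((p : ℤ) * N) := fun n => by
        exact_mod_cast (Nat.isCoprime_iff_coprime.2 h2).pow_left (m := n)
      have h4 : A 4 (fun a => a % 4 = 3) * 2 ^ (k + 2) = (8 * (p * N)).totient := by
        rw [← hR3, ← hcount 4 (fun a => a % 4 = 3) (fun a b h h' => (hmod h).symm.trans h')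
          (fun a h => by omega) (h2' 2) (fun i hi => absurd hi (hN2 i)), pow_succ, mul_assoc]
      have h8 : A 8 (fun a => a % 2 = 1) * 2 ^ (k + 1) = (8 * (p * N)).totient := by
        rw [hA]
        dsimp only
        rw [← hR, hcount 8 (fun a => a % 2 = 1) (fun a b h h' => by have := hmod h; omega)
          (fun a h => h) (h2' 3) (fun i hi => absurd hi (hN2 i))]
        congr 1
        ext a
        exact and_iff_left_of_imp (emod_two_eq_one_of_isCoprime ⟨4 * (p * N), by rw [hcast]; ring⟩)
      rw [prod_union, prod_singleton] at hmain
      · have e4 : A 4 (fun a => a % 4 = 3) = A 1 (fun a => a % 4 = 1) :=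
          Nat.eq_of_mul_eq_mul_right (by positivity) (h4.trans h1.symm)
        have e8 : A 8 (fun a => a % 2 = 1) = 2 * A 1 (fun a => a % 4 = 1) := by
          refine Nat.eq_of_mul_eq_mul_right (show 0 < 2 ^ (k + 1) by positivity) ?_
          rw [h8, ← h1]
          ring
        rw [e4, e8]
        rw [mul_comm (2 ^ (k + 2) : ℝ), ← div_div, div_eq_iff (by positivity)]
        push_cast at hmain ⊢
        linear_combination -3 / 2 * hmain
      · rw [disjoint_singleton_left]
        intro h
        have := h2.eq_one_of_dvd (Nat.dvd_of_mem_primeFactors h)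
        norm_num at this
  · rintro a b hab ⟨h1, h2, h3⟩
    have hi : ∀ i, InertIn (q i) b ↔ InertIn (q i) a := fun i => by
      have : a ≡ b [ZMOD 8 * q i] := hab.of_dvd (hcast ▸ mul_dvd_mul_left _ (hqN i))
      exact ⟨InertIn.congr this.symm, InertIn.congr this⟩
    simp only [hi]
    refine ⟨?_, h2, h3⟩
    rw [← Int.isCoprime_iff_gcd_eq_one] at h1 ⊢
    exact h1.of_int_modEq (hab.of_dvd (hcast ▸ dvd_mul_left _ _))
  · rintro c e he ⟨h1, -⟩
    rw [← Int.isCoprime_iff_gcd_eq_one] at h1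
    rw [hcast]
    exact (isCoprime_of_odd he 3).mul_right h1.of_mul_left_right

/-- Theorem 4.9 (density of `Q⁻(choired, p±)`, good ordinary case): Let `p > 3` be prime,
`q 0, …, q (r-1)` distinct primes different from `p` with `N = ∏ i, q i` squarefree, and
`0 ≤ k < r`. The set of negative fundamental discriminants `D` coprime to `pN` such that the
set `I` of indices `i` with `q i` inert in `ℚ(√D)` satisfies `I ⊆ {k, …, r-1}` (indices
`0`-based) and `#I` odd — with no condition on the behaviour of `p` in `ℚ(√D)` — has density
`pN / (2^(k+1) (p+1) ∏ i (q i + 1))` among all negative fundamental discriminants. -/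
theorem density_choired_ordinary (p : ℕ) (hp : p.Prime) (hp3 : 3 < p)
    (r : ℕ) (q : Fin r → ℕ) (hq : ∀ i, (q i).Prime) (hqp : ∀ i, q i ≠ p)
    (hqinj : Function.Injective q) (N : ℕ) (hN : N = ∏ i, q i) (hNsf : Squarefree N)
    (k : ℕ) (hk : k < r) :
    Filter.Tendsto
      (fun x : ℝ =>
        (Nat.card {D : ℤ | IsNegFundDisc D ∧ |(D : ℝ)| < x ∧
            Int.gcd D ((p : ℤ) * N) = 1 ∧
            (∀ i : Fin r, InertIn (q i) D → k ≤ (i : ℕ)) ∧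
            Odd (Nat.card {i : Fin r // InertIn (q i) D})} : ℝ) /
          (Nat.card {D : ℤ | IsNegFundDisc D ∧ |(D : ℝ)| < x} : ℝ))
      Filter.atTop
      (nhds ((p : ℝ) * N /
        (2 ^ (k + 1) * ((p : ℝ) + 1) * ∏ i, ((q i : ℝ) + 1)))) := by
  subst hN
  have h := (tendsto_card_inertIn_div hp hp3 hq hqp hqinj hk).div tendsto_card_isNegFundDisc_lt_div
    (by positivity)
  have e : (p / (p + 1) : ℝ) * (∏ i, (q i : ℝ) / (q i + 1)) / (2 ^ (k + 2) * (Real.pi ^ 2 / 6)) /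
      (1 / (2 * (Real.pi ^ 2 / 6))) = (p : ℝ) * (∏ i, q i : ℕ) /
        (2 ^ (k + 1) * ((p : ℝ) + 1) * ∏ i, ((q i : ℝ) + 1)) := by
    have : (∏ i, ((q i : ℝ) + 1)) ≠ 0 := prod_ne_zero_iff.2 fun i _ => by positivity
    rw [prod_div_distrib]
    push_cast
    field_simp
    ring
  rw [e] at h
  refine h.congr' ?_
  filter_upwards [eventually_gt_atTop 0] with x hx
  exact div_div_div_cancel_right₀ hx.ne' _ _
end
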